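/- Let 𝓔̄ denote the quotient of the space 𝓔 of all subfields of Q̄ by the equivalence relation identifying two subfields when they are isomorphic as fields, equipped with the quotient topology. Then the set of isomorphism classes of subfields F of Q̄ such that ℤ is definable in F, or the ring of integers 𝒪_F (the integral closure of ℤ in F) is definable in F, or a fixed number field K ⊆ F is definable in F (in each case by a first-order formula in the language of rings with parameters from F), is a meager subset of 𝓔̄. -/

import Mathlib

open FirstOrder Topology

noncomputable section

/-- `Q̄`, the algebraic closure of `ℚ`. -/
abbrev Qbar : Type := AlgebraicClosure ℚ

/-- `Prop` with the discrete two-point topology. -/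
def propDiscrete : TopologicalSpace Prop := ⊥

/-- The product topology on the powerset `2^Q̄`, identified with `Set Q̄ = Q̄ → Prop`,
where each factor `Prop` carries the discrete two-point topology. -/
def powersetTopology : TopologicalSpace (Set Qbar) :=
  @Pi.topologicalSpace Qbar (fun _ => Prop) (fun _ => propDiscrete)

/-- The space `𝓔` of all subfields of `Q̄`, with the subspace topology induced from `2^Q̄`
via the identification of a subfield with its underlying set of elements. -/
instance subfieldTopology : TopologicalSpace (Subfield Qbar) :=
  powersetTopology.induced (fun F => (F : Set Qbar))

/-- A subset `s` of a field `F` is definable (with parameters) if it is the solution set in `F`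
of a first-order formula in the language of rings with parameters from `F`. -/
def DefinableIn (F : Type*) [Field F] (s : Set F) : Prop :=
  letI := FirstOrder.Ring.compatibleRingOfRing F
  Set.Definable₁ (Set.univ : Set F) FirstOrder.Language.ring s

/-- The subset `ℤ` of a field `F`. -/
def intSet (F : Type*) [Field F] : Set F := Set.range (Int.cast : ℤ → F)

/-- The ring of integers `𝒪_F` of `F`: the integral closure of `ℤ` in `F`. -/
def ringOfIntegers (F : Type*) [Field F] : Set F := {x : F | IsIntegral ℤ x}

/-- Two subfields of `Q̄` are equivalent iff they are isomorphic as fields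
(equivalently, as rings). -/
def isoSetoid : Setoid (Subfield Qbar) where
  r F K := Nonempty (F ≃+* K)
  iseqv := ⟨fun _ => ⟨RingEquiv.refl _⟩, fun ⟨e⟩ => ⟨e.symm⟩, fun ⟨e⟩ ⟨e'⟩ => ⟨e.trans e'⟩⟩

/-- The space `𝓔̄`: the quotient of the space `𝓔` of all subfields of `Q̄` by field
isomorphism, with the quotient topology. -/
abbrev EBar : Type := Quotient isoSetoid

section
open Polynomial

theorem exists_interpolation_relation (s : Finset ℕ) (c : ℕ) :
    ∃ (Δ : ℤ) (μ : ℕ → ℤ), Δ ≠ 0 ∧ ∀ n < s.card, Δ * (c : ℤ) ^ n = ∑ i ∈ s, μ i * (i : ℤ) ^ n := by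
  classical
  let b : ℕ → ℚ := fun i => eval (c : ℚ) (Lagrange.basis s (Nat.cast : ℕ → ℚ) i)
  obtain ⟨Δ, hΔ⟩ := IsLocalization.exist_integer_multiples (nonZeroDivisors ℤ) s b
  choose! μ hμ using hΔ
  refine ⟨Δ, μ, nonZeroDivisors.coe_ne_zero Δ, fun n hn => ?_⟩
  have h : (X ^ n : ℚ[X]) = Lagrange.interpolate s (Nat.cast : ℕ → ℚ) (fun i => (i : ℚ) ^ n) := by
    apply Lagrange.eq_interpolate_of_eval_eq
    · exact Nat.cast_injective.injOn
    · rw [degree_X_pow]; exact_mod_cast hn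
    · intro i _; simp
  have h2 := congrArg (eval (c : ℚ)) h
  rw [Lagrange.interpolate_apply, eval_finsetSum] at h2
  simp only [eval_pow, eval_X, eval_mul, eval_C] at h2
  have : ((Δ * (c : ℤ) ^ n : ℤ) : ℚ) = ((∑ i ∈ s, μ i * (i : ℤ) ^ n : ℤ) : ℚ) := by
    push_cast
    rw [h2, Finset.mul_sum]
    refine Finset.sum_congr rfl fun i hi => ?_
    have := hμ i hi
    simp only [algebraMap_int_eq, eq_intCast, zsmul_eq_mul] at this
    rw [this]
    simp only [b]; ring
  exact_mod_cast this

theorem exists_bounded_interpolation_relation (H : ℕ) :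
    ∃ W : ℕ, ∀ s ⊆ Finset.range H, ∀ c < H, ∃ (Δ : ℤ) (μ : ℕ → ℤ), Δ ≠ 0 ∧ |Δ| ≤ W ∧
      (∀ i ∈ s, |μ i| ≤ W) ∧ ∀ n < s.card, Δ * (c : ℤ) ^ n = ∑ i ∈ s, μ i * (i : ℤ) ^ n := by
  classical
  choose Δ μ h0 h using exists_interpolation_relation
  let T := ((Finset.range H).powerset ×ˢ Finset.range H)
  let B : Finset ℕ × ℕ → ℕ := fun x => (Δ x.1 x.2).natAbs + ∑ i ∈ x.1, (μ x.1 x.2 i).natAbs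
  refine ⟨T.sup B, fun s hs c hc => ⟨Δ s c, μ s c, h0 s c, ?_, ?_, h s c⟩⟩
  all_goals have hB : B (s, c) ≤ T.sup B := Finset.le_sup (f := B) (by simp [T, hs, hc])
  · have : (Δ s c).natAbs ≤ T.sup B := by simp only [B] at hB ⊢; omega
    rw [Int.abs_eq_natAbs]; exact_mod_cast this
  · intro i hi
    have : (μ s c i).natAbs ≤ ∑ i ∈ s, (μ s c i).natAbs :=
      Finset.single_le_sum (f := fun i => (μ s c i).natAbs) (fun _ _ => Nat.zero_le _) hi
    have : (μ s c i).natAbs ≤ T.sup B := by simp only [B] at hB ⊢; omega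
    rw [Int.abs_eq_natAbs]; exact_mod_cast this

theorem eval_map_hom {A B : Type*} [CommRing A] [CommRing B] (ψ : A →+* B) (P : A[X]) (x : A) :
    eval (ψ x) (P.map ψ) = ψ (eval x P) := by
  rw [eval_map, eval₂_at_apply]

theorem exists_polynomial_root {A : Type*} [CommRing A] (g : A[X][X]) (s y : A)
    (h0 : IsNilpotent (eval y (g.map (evalRingHom s))))
    (h1 : IsUnit (eval y (derivative (g.map (evalRingHom s))))) (m : ℕ) :
    ∃ r : A[X], r.degree < m ∧ ∀ ε : A, ε ^ m = 0 → ∀ z, IsNilpotent (y - z) →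
      eval z (g.map (evalRingHom (s + ε))) = 0 → z = eval ε r := by
  rcases subsingleton_or_nontrivial A with hA | hA
  · exact ⟨0, by simp, fun _ _ _ _ _ => Subsingleton.elim _ _⟩
  let q : A[X] →+* AdjoinRoot (X ^ m : A[X]) := AdjoinRoot.mk _
  let τ : A[X] →+* A[X] := eval₂RingHom C (X + C s)
  let x : A[X] := C y
  have hX : IsNilpotent (q X) := ⟨m, by rw [← map_pow]; exact AdjoinRoot.mk_self⟩
  have key : ∀ p : A[X], ∃ p', p = C (eval 0 p) + X * p' := by
    intro p
    refine ⟨divX p, ?_⟩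
    conv_lhs => rw [← divX_mul_X_add p]
    rw [coeff_zero_eq_eval_zero]; ring
  have ev : ∀ (ε : A) (G : A[X][X]), eval ε (eval x (G.map τ)) =
      eval y (G.map (evalRingHom (s + ε))) := by
    intro ε G
    have h := eval_map_hom (evalRingHom ε) (G.map τ) x
    rw [coe_evalRingHom] at h
    rw [← h, Polynomial.map_map]
    simp only [x, eval_C]
    congr 2
    ext <;> simp [τ, add_comm]
  have e0 : ∀ G : A[X][X], ∃ n : AdjoinRoot (X ^ m : A[X]), IsNilpotent n ∧
      eval (q x) (G.map (q.comp τ)) = q (C (eval y (G.map (evalRingHom s)))) + n := by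
    intro G
    obtain ⟨p', hp'⟩ := key (eval x (G.map τ))
    refine ⟨q X * q p', (Commute.all _ _).isNilpotent_mul_right hX, ?_⟩
    rw [← Polynomial.map_map, eval_map_hom]
    conv_lhs => rw [hp', ev]
    simp
  have n0 : IsNilpotent (aeval (q x) (g.map (q.comp τ))) := by
    rw [coe_aeval_eq_eval]
    obtain ⟨n, hn, h⟩ := e0 g
    rw [h]
    exact (Commute.all _ _).isNilpotent_add ((h0.map C).map q) hn
  have u0 : IsUnit (aeval (q x) (derivative (g.map (q.comp τ)))) := by
    rw [coe_aeval_eq_eval, derivative_map]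
    obtain ⟨n, hn, h⟩ := e0 (derivative g)
    rw [h]
    rw [derivative_map] at h1
    exact IsNilpotent.isUnit_add_left_of_commute hn ((h1.map C).map q) (Commute.all _ _)
  obtain ⟨r', ⟨hr1, hr2⟩, -⟩ := existsUnique_nilpotent_sub_and_aeval_eq_zero n0 u0
  obtain ⟨r, rfl⟩ := AdjoinRoot.mk_surjective r'
  have hmon : (X ^ m : A[X]).Monic := monic_X_pow m
  have hqr : q (r %ₘ X ^ m) = AdjoinRoot.mk _ r := by
    conv_rhs => rw [← modByMonic_add_div r (X ^ m), map_add, map_mul]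
    simp [q]
  rw [← hqr] at hr1 hr2
  refine ⟨r %ₘ X ^ m, ?_, fun ε hε z hz hgz => ?_⟩
  · simpa using degree_modByMonic_lt r hmon
  set r1 := r %ₘ X ^ m
  let ψ : AdjoinRoot (X ^ m : A[X]) →+* A := AdjoinRoot.lift (RingHom.id A) ε (by simp [hε])
  have hψ : ∀ p, ψ (q p) = eval ε p := by
    intro p; simp [ψ, q, AdjoinRoot.lift_mk, eval₂_id]
  have hcomp : ψ.comp (q.comp τ) = evalRingHom (s + ε) := by
    ext <;> simp [hψ, τ, add_comm]
  have hyx : ψ (q x) = y := by simp [hψ, x]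
  have N := n0.map ψ
  have U := u0.map ψ
  rw [coe_aeval_eq_eval, ← eval_map_hom, derivative_map, Polynomial.map_map, hcomp, hyx,
    ← derivative_map] at U
  rw [coe_aeval_eq_eval, ← eval_map_hom, Polynomial.map_map, hcomp, hyx] at N
  refine (existsUnique_nilpotent_sub_and_aeval_eq_zero (P := g.map (evalRingHom (s + ε)))
    (x := y) (by rwa [coe_aeval_eq_eval]) (by rwa [coe_aeval_eq_eval])).unique
      ⟨hz, by rwa [coe_aeval_eq_eval]⟩ ⟨?_, ?_⟩
  · have := hr1.map ψ
    rwa [map_sub, hyx, hψ] at this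
  · have := congrArg ψ hr2
    rwa [coe_aeval_eq_eval, ← eval_map_hom, Polynomial.map_map, hcomp, hψ, map_zero] at this

end

section
open Polynomial NumberField

/-- A set of natural numbers which meets long arithmetic progressions `s₀ + p ^ k * u`, with `p`
outside an explicit finite set of primes depending on `s₀`, in boundedly many points. -/
def Sparse (S : Set ℕ) : Prop :=
  ∃ E : ℕ → ℕ, (∃ n, ∀ s ≥ n, E s ≠ 0) ∧ ∀ s₀ p : ℕ, p.Prime → ¬ p ∣ E s₀ →
    ∃ M, ∀ H, ∃ k₀, ∀ k ≥ k₀, ∀ T ⊆ Finset.range H, (∀ u ∈ T, s₀ + p ^ k * u ∈ S) → T.card ≤ M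

theorem house_eval_natCast_le {N : Type*} [Field N] [NumberField N] (q : (𝓞 N)[X]) :
    ∃ C : ℝ, 0 ≤ C ∧ ∀ n ≥ q.natDegree, ∀ s : ℕ,
      house ((q.eval (s : 𝓞 N) : 𝓞 N) : N) ≤ C * (1 + s) ^ n := by
  refine ⟨∑ i ∈ Finset.range (q.natDegree + 1), house (q.coeff i : N),
    Finset.sum_nonneg fun _ _ => house_nonneg _, fun n hn s => ?_⟩
  have hq : ((q.eval (s : 𝓞 N) : 𝓞 N) : N) =
      ∑ i ∈ Finset.range (q.natDegree + 1), (q.coeff i : N) * (s : N) ^ i := by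
    rw [eval_eq_sum_range]; simp
  rw [hq, Finset.sum_mul]
  refine (house_sum_le_sum_house _ _).trans (Finset.sum_le_sum fun i hi => ?_)
  refine (house_mul_le _ _).trans (mul_le_mul_of_nonneg_left ?_ (house_nonneg _))
  have h1 : house ((s : N) ^ i) ≤ (s : ℝ) ^ i := by
    refine (house_pow_le _ _).trans (le_of_eq ?_)
    have := house_intCast (K := N) (s : ℤ)
    rw [Int.cast_natCast] at this
    rw [this]; simp
  refine h1.trans ((pow_le_pow_left₀ (by positivity) (by linarith) i).trans
    (pow_le_pow_right₀ (by linarith [(Nat.cast_nonneg s : (0 : ℝ) ≤ s)]) ?_))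
  have := Finset.mem_range.1 hi
  omega

theorem norm_root_le {P : ℂ[X]} (hP : P.Monic) {z : ℂ} (hz : P.IsRoot z) :
    ‖z‖ ≤ 1 + ∑ i ∈ Finset.range P.natDegree, ‖P.coeff i‖ := by
  have h := hz.norm_lt_cauchyBound hP.ne_zero
  have h2 : P.cauchyBound ≤ 1 + ∑ i ∈ Finset.range P.natDegree, ‖P.coeff i‖₊ := by
    rw [cauchyBound, hP.leadingCoeff, add_comm]
    simp only [nnnorm_one, div_one, add_le_add_iff_left]
    exact Finset.sup_le fun i hi =>
      Finset.single_le_sum (f := fun i => ‖P.coeff i‖₊) (fun _ _ => zero_le) hi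
  have h3 := (h.le.trans h2)
  have h4 := NNReal.coe_le_coe.2 h3
  push_cast at h4
  exact h4

theorem house_root_le {N : Type*} [Field N] [NumberField N] {g : (𝓞 N)[X][X]} (hg : g.Monic) :
    ∃ (C : ℝ) (G : ℕ), 0 ≤ C ∧ ∀ (s : ℕ) (y : 𝓞 N),
      eval y (g.map (evalRingHom (s : 𝓞 N))) = 0 → house (y : N) ≤ C * (1 + s) ^ G := by
  choose c hc0 hc using fun q : (𝓞 N)[X] => house_eval_natCast_le q
  let G := (Finset.range g.natDegree).sup fun i => (g.coeff i).natDegree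
  have hS : 0 ≤ ∑ i ∈ Finset.range g.natDegree, c (g.coeff i) := Finset.sum_nonneg fun _ _ => hc0 _
  refine ⟨1 + ∑ i ∈ Finset.range g.natDegree, c (g.coeff i), G, by linarith, fun s y hy => ?_⟩
  rw [house_eq_sup']
  have key : ∀ σ : N →+* ℂ, ‖σ y‖ ≤
      (1 + ∑ i ∈ Finset.range g.natDegree, c (g.coeff i)) * (1 + s) ^ G := by
    intro σ
    let τ : 𝓞 N →+* ℂ := σ.comp (algebraMap (𝓞 N) N)
    let P := (g.map (evalRingHom (s : 𝓞 N))).map τ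
    have hm : P.Monic := (hg.map _).map _
    have hd : P.natDegree = g.natDegree := by
      rw [(hg.map _).natDegree_map, hg.natDegree_map]
    have hr : P.IsRoot (τ y) := by
      rw [IsRoot, eval_map_hom, hy, map_zero]
    refine (norm_root_le hm hr).trans ?_
    rw [hd, add_mul, one_mul, Finset.sum_mul]
    have h1 : (1 : ℝ) ≤ 1 + s := by linarith [(Nat.cast_nonneg s : (0 : ℝ) ≤ s)]
    refine add_le_add (one_le_pow₀ h1) (Finset.sum_le_sum fun i hi => ?_)
    refine le_trans ?_ (hc (g.coeff i) G
      (Finset.le_sup (f := fun i => (g.coeff i).natDegree) hi) s)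
    rw [coeff_map, coeff_map]
    exact norm_embedding_le_house _ σ
  exact_mod_cast Finset.sup'_le (f := fun σ : N →+* ℂ => ‖σ y‖₊)
    (a := ⟨_, (norm_nonneg _).trans (key (Classical.arbitrary _))⟩) _ fun σ _ => key σ

/-- The values of `r` at the multiples of `q` satisfy the linear relations of polynomials of small
degree. -/
theorem eval_relation {A : Type*} [CommRing A] {m : ℕ} {r : A[X]} (hr : r.degree < m) (q : A)
    (s : Finset ℕ) (hs : s.card = m) (c : ℕ) (Δ : ℤ) (μ : ℕ → ℤ)
    (h : ∀ n < s.card, Δ * (c : ℤ) ^ n = ∑ i ∈ s, μ i * (i : ℤ) ^ n) :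
    (Δ : A) * eval (q * c) r = ∑ i ∈ s, (μ i : A) * eval (q * i) r := by
  have hsum : ∀ x : A, eval x r = ∑ n ∈ Finset.range m, r.coeff n * x ^ n := fun x => by
    rcases eq_or_ne r 0 with rfl | h0
    · simp
    · exact eval_eq_sum_range' ((natDegree_lt_iff_degree_lt h0).2 hr) x
  simp only [hsum, Finset.mul_sum]
  rw [Finset.sum_comm]
  refine Finset.sum_congr rfl fun n hn => ?_
  have := congrArg (Int.cast : ℤ → A) (h n (by rw [hs]; exact Finset.mem_range.1 hn))
  push_cast at this
  calc (Δ : A) * (r.coeff n * (q * c) ^ n) = r.coeff n * q ^ n * (Δ * (c : A) ^ n) := by ring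
    _ = _ := by rw [this, Finset.mul_sum]; exact Finset.sum_congr rfl fun i _ => by ring

theorem eq_zero_of_natCast_dvd_of_house_lt {N : Type*} [Field N] [NumberField N] {q : ℕ}
    {δ : 𝓞 N} (h : (q : 𝓞 N) ∣ δ) (hq : house (δ : N) < q) : δ = 0 := by
  obtain ⟨γ, rfl⟩ := h
  by_contra hne
  have hγ : γ ≠ 0 := right_ne_zero_of_mul hne
  have h1 := one_le_house_of_isIntegral (K := N) (α := (γ : N)) γ.isIntegral_coe
    (by simpa using hγ)
  have e : (((q : 𝓞 N) * γ : 𝓞 N) : N) = (q : N) * γ := by simp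
  rw [e, house_nat_mul] at hq
  nlinarith [(Nat.cast_nonneg q : (0 : ℝ) ≤ q)]

theorem house_relation_le {N : Type*} [Field N] [NumberField N] {W : ℕ} {B : ℝ} (s : Finset ℕ)
    (y : ℕ → 𝓞 N) (c : ℕ) (Δ : ℤ) (μ : ℕ → ℤ) (hΔ : |Δ| ≤ W) (hμ : ∀ i ∈ s, |μ i| ≤ W)
    (hc : house (y c : N) ≤ B) (hs : ∀ i ∈ s, house (y i : N) ≤ B) :
    house ((Δ * y c - ∑ i ∈ s, μ i * y i : 𝓞 N) : N) ≤ (s.card + 1) * (W * B) := by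
  have h1 : ∀ (a : ℤ) (i : ℕ), |a| ≤ W → house (y i : N) ≤ B → house (a * y i : N) ≤ W * B := by
    intro a i ha hi
    refine (house_mul_le _ _).trans (mul_le_mul ?_ hi (house_nonneg _) (by positivity))
    rw [house_intCast]
    exact_mod_cast ha
  have e : ((Δ * y c - ∑ i ∈ s, μ i * y i : 𝓞 N) : N) =
      Δ * y c + ∑ i ∈ s, ((-μ i : ℤ) : N) * y i := by
    simp [sub_eq_add_neg]
  rw [e]
  refine (house_add_le _ _).trans ?_
  have h2 := (house_sum_le_sum_house s fun i => ((-μ i : ℤ) : N) * y i).trans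
    (Finset.sum_le_card_nsmul s _ (W * B) fun i hi => h1 _ i (by rw [abs_neg]; exact hμ i hi)
      (hs i hi))
  rw [nsmul_eq_mul] at h2
  linarith [h1 Δ c hΔ hc]

theorem natDegree_eval_le {N : Type*} [Field N] (g : N[X][X]) (m : ℕ) :
    ∃ D, ∀ U a : N[X], U.natDegree ≤ m → a.natDegree ≤ 1 →
      (eval U (g.map (compRingHom a))).natDegree ≤ D := by
  refine ⟨(Finset.range (g.natDegree + 1)).sup fun i => (g.coeff i).natDegree + i * m,
    fun U a hU ha => ?_⟩
  rw [eval_map, eval₂_eq_sum_range]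
  refine natDegree_sum_le_of_forall_le _ _ fun i hi => ?_
  refine le_trans ?_ (Finset.le_sup (f := fun i => (g.coeff i).natDegree + i * m) hi)
  refine natDegree_mul_le.trans (add_le_add ?_ ?_)
  · rw [coe_compRingHom_apply, natDegree_comp]
    nlinarith
  · exact natDegree_pow_le.trans (Nat.mul_le_mul_left i hU)

theorem interpolate_natCast_eval {N : Type*} [Field N] [CharZero N] (s : Finset ℕ) (y : ℕ → N)
    (c : ℕ) (Δ : ℤ) (μ : ℕ → ℤ) (h0 : Δ ≠ 0)
    (h : ∀ n < s.card, Δ * (c : ℤ) ^ n = ∑ i ∈ s, μ i * (i : ℤ) ^ n)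
    (hy : Δ * y c = ∑ i ∈ s, μ i * y i) :
    eval (c : N) (Lagrange.interpolate s (Nat.cast : ℕ → N) y) = y c := by
  classical
  have hinj : Set.InjOn (Nat.cast : ℕ → N) s := Nat.cast_injective.injOn
  have h1 := eval_relation (Lagrange.degree_interpolate_lt y hinj) 1 s rfl c Δ μ h
  simp only [one_mul] at h1
  have h2 : ∑ i ∈ s, (μ i : N) * eval (i : N) (Lagrange.interpolate s (Nat.cast : ℕ → N) y) =
      ∑ i ∈ s, μ i * y i :=
    Finset.sum_congr rfl fun i hi => by rw [Lagrange.eval_interpolate_at_node y hinj hi]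
  rw [h2, ← hy] at h1
  exact mul_left_cancel₀ (Int.cast_ne_zero.2 h0) h1

theorem sparse_root {N : Type*} [Field N] [NumberField N] {g a b : (𝓞 N)[X][X]} {e : (𝓞 N)[X]}
    (hg : g.Monic) (he : e ≠ 0) (hab : a * g + b * derivative g = C e)
    (hroot : ∀ U : N[X], eval U (g.map (mapRingHom (algebraMap (𝓞 N) N))) ≠ 0) :
    Sparse {s | ∃ y : 𝓞 N, eval y (g.map (evalRingHom (s : 𝓞 N))) = 0} := by
  classical
  refine ⟨fun s => Ideal.absNorm (Ideal.span {e.eval (s : 𝓞 N)}), ?_, ?_⟩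
  · have hfin : {s : ℕ | e.eval (s : 𝓞 N) = 0}.Finite := by
      refine Set.Finite.of_finite_image ((e.roots.toFinset.finite_toSet).subset ?_)
        (Nat.cast_injective (R := 𝓞 N)).injOn
      rintro _ ⟨s, hs, rfl⟩
      simpa [he] using hs
    obtain ⟨n, hn⟩ := hfin.bddAbove
    refine ⟨n + 1, fun s hs h => ?_⟩
    rw [Ideal.absNorm_eq_zero_iff, Ideal.span_singleton_eq_bot] at h
    exact absurd (hn h) (by omega)
  intro s₀ p hp hps
  obtain ⟨B, G, hB0, hB⟩ := house_root_le hg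
  let m := G + 1
  obtain ⟨D, hD⟩ := natDegree_eval_le (g.map (mapRingHom (algebraMap (𝓞 N) N))) m
  have : Finite (𝓞 N ⧸ Ideal.span {(p : 𝓞 N)}) := Ideal.finiteQuotientOfFreeOfNeBot _ (by
    simpa using hp.ne_zero)
  let _ := Fintype.ofFinite (𝓞 N ⧸ Ideal.span {(p : 𝓞 N)})
  refine ⟨Fintype.card (𝓞 N ⧸ Ideal.span {(p : 𝓞 N)}) * (D + m), fun H => ?_⟩
  obtain ⟨W, hW⟩ := exists_bounded_interpolation_relation H
  obtain ⟨k₀, hk₀⟩ := exists_nat_gt ((m + 1) * (W * (B * (1 + s₀ + H) ^ G)) : ℝ)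
  refine ⟨k₀, fun k hk T hTH hTS => ?_⟩
  by_contra! hcard
  choose! y hy using hTS
  obtain ⟨cl, -, hcl⟩ := Finset.exists_lt_card_fiber_of_mul_lt_card_of_maps_to
    (f := fun u => Ideal.Quotient.mk (Ideal.span {(p : 𝓞 N)}) (y u)) (s := T) (t := Finset.univ)
    (fun _ _ => Finset.mem_univ _) (by simpa using hcard)
  set T' := T.filter fun u => Ideal.Quotient.mk (Ideal.span {(p : 𝓞 N)}) (y u) = cl
  have hT'T : T' ⊆ T := Finset.filter_subset _ _
  have hT' : ∀ u ∈ T', ∀ v ∈ T', (p : 𝓞 N) ∣ y u - y v := by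
    intro u hu v hv
    rw [← Ideal.mem_span_singleton, ← Ideal.Quotient.eq, (Finset.mem_filter.1 hu).2,
      (Finset.mem_filter.1 hv).2]
  obtain ⟨u₀, hu₀⟩ : T'.Nonempty := Finset.card_pos.1 (by omega)
  -- all points of the class lie on a polynomial modulo `p ^ (k * m)`
  let I : Ideal (𝓞 N) := Ideal.span {((p ^ (k * m) : ℕ) : 𝓞 N)}
  let π := Ideal.Quotient.mk I
  have hpn : IsNilpotent (π p) := ⟨k * m, by
    rw [← map_pow, Ideal.Quotient.eq_zero_iff_mem]
    exact Ideal.mem_span_singleton.2 (by push_cast; rfl)⟩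
  have hnil : ∀ x : 𝓞 N, (p : 𝓞 N) ∣ x → IsNilpotent (π x) := by
    rintro _ ⟨z, rfl⟩
    rw [map_mul]
    exact (Commute.all _ _).isNilpotent_mul_right hpn
  have hπ : ∀ (P : (𝓞 N)[X][X]) (s y : 𝓞 N), eval (π y) ((P.map (mapRingHom π)).map
      (evalRingHom (π s))) = π (eval y (P.map (evalRingHom s))) := by
    intro P s y
    rw [← eval_map_hom, Polynomial.map_map, Polynomial.map_map]
    congr 2
    ext <;> simp
  have hev : ∀ (P : (𝓞 N)[X][X]) (s y : 𝓞 N), eval y (P.map (evalRingHom s)) =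
      eval s (eval (C y) P) := by
    intro P s y
    have := eval_map_hom (evalRingHom s) P (C y)
    rwa [coe_evalRingHom, eval_C] at this
  have hk1 : 1 ≤ k := by
    have h0 : (0 : ℝ) < k₀ := lt_of_le_of_lt (by positivity) hk₀
    have : 0 < k₀ := by exact_mod_cast h0
    omega
  have hg0 : IsNilpotent (π (eval (y u₀) (g.map (evalRingHom (s₀ : 𝓞 N))))) := by
    refine hnil _ ?_
    have h1 := sub_dvd_eval_sub (s₀ : 𝓞 N) ((s₀ + p ^ k * u₀ : ℕ) : 𝓞 N) (eval (C (y u₀)) g)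
    have h2 := hy u₀ (hT'T hu₀)
    rw [hev] at h2
    rw [h2, sub_zero] at h1
    rw [hev]
    refine dvd_trans ?_ h1
    push_cast
    rw [sub_add_cancel_left]
    exact dvd_neg.2 (Dvd.dvd.mul_right (dvd_pow_self _ (by omega)) _)
  have hg1 : IsUnit (π (eval (y u₀) ((derivative g).map (evalRingHom (s₀ : 𝓞 N))))) := by
    have h1 := congrArg (fun P => π (eval (s₀ : 𝓞 N) (eval (C (y u₀)) P))) hab
    simp only [eval_add, eval_mul, eval_C, map_add, map_mul, ← hev] at h1
    have h2 : IsUnit (π (eval (s₀ : 𝓞 N) e)) := by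
      have hdvd : eval (s₀ : 𝓞 N) e ∣ (Ideal.absNorm (Ideal.span {e.eval (s₀ : 𝓞 N)}) : 𝓞 N) :=
        Ideal.mem_span_singleton.1 (Ideal.absNorm_mem _)
      refine isUnit_of_dvd_unit (map_dvd π hdvd) ?_
      obtain ⟨u, v, huv⟩ := Nat.isCoprime_iff_coprime.2
        (((Nat.Prime.coprime_iff_not_dvd hp).2 hps).symm.pow_right (k * m))
      have h3 := congrArg (fun z : ℤ => π (z : 𝓞 N)) huv
      have h4 : π (((p ^ (k * m) : ℕ) : 𝓞 N)) = 0 :=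
        Ideal.Quotient.eq_zero_iff_mem.2 (Ideal.mem_span_singleton_self _)
      simp only [Int.cast_add, Int.cast_mul, Int.cast_natCast, map_add, map_mul, h4, mul_zero,
        add_zero, Int.cast_one, map_one] at h3
      exact IsUnit.of_mul_eq_one_right _ h3
    have h3 : IsUnit (π (eval (y u₀) (b.map (evalRingHom (s₀ : 𝓞 N)))) *
        π (eval (y u₀) ((derivative g).map (evalRingHom (s₀ : 𝓞 N))))) := by
      rw [← eq_sub_iff_add_eq'] at h1
      rw [h1, sub_eq_add_neg]
      refine IsNilpotent.isUnit_add_left_of_commute ?_ h2 (Commute.all _ _)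
      exact ((Commute.all _ _).isNilpotent_mul_left hg0).neg
    exact isUnit_of_mul_isUnit_right h3
  obtain ⟨r, hr, hr'⟩ := exists_polynomial_root (g.map (mapRingHom π)) (π s₀) (π (y u₀))
    (by rwa [hπ]) (by rwa [derivative_map, derivative_map, hπ]) m
  have hyr : ∀ u ∈ T', π (y u) = eval (π (p ^ k) * u) r := by
    intro u hu
    refine hr' _ ?_ _ ?_ ?_
    · rw [mul_pow, ← map_pow, ← pow_mul]
      have h4 : π (((p ^ (k * m) : ℕ) : 𝓞 N)) = 0 :=
        Ideal.Quotient.eq_zero_iff_mem.2 (Ideal.mem_span_singleton_self _)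
      push_cast at h4
      rw [h4, zero_mul]
    · rw [← map_sub]
      exact hnil _ (hT' _ hu₀ _ hu)
    · have := hy u (hT'T hu)
      rw [← map_natCast π u, ← map_mul, ← map_add, hπ]
      push_cast at this
      rw [this, map_zero]
  have hlin : ∀ s ⊆ T', s.card = m → ∀ c ∈ T', ∃ (Δ : ℤ) (μ : ℕ → ℤ), Δ ≠ 0 ∧
      (∀ n < s.card, Δ * (c : ℤ) ^ n = ∑ i ∈ s, μ i * (i : ℤ) ^ n) ∧
      Δ * y c = ∑ i ∈ s, μ i * y i := by
    intro s hs hsm c hc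
    obtain ⟨Δ, μ, h0, hΔ, hμ, h⟩ := hW s (hs.trans (hT'T.trans hTH)) c
      (Finset.mem_range.1 (hTH (hT'T hc)))
    refine ⟨Δ, μ, h0, h, ?_⟩
    rw [← sub_eq_zero]
    refine eq_zero_of_natCast_dvd_of_house_lt (q := p ^ (k * m)) ?_ ?_
    · rw [← Ideal.mem_span_singleton]
      change _ ∈ I
      rw [← Ideal.Quotient.eq_zero_iff_mem]
      change π _ = 0
      rw [map_sub, map_sum, map_mul, hyr c hc, map_intCast,
        eval_relation hr (π (p ^ k)) s hsm c Δ μ h, sub_eq_zero]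
      exact Finset.sum_congr rfl fun i hi => by rw [map_mul, map_intCast, hyr i (hs hi)]
    · have hyB : ∀ i ∈ T', house (y i : N) ≤ B * (1 + s₀ + H) ^ G * (p ^ k) ^ G := by
        intro i hi
        refine (hB _ _ (hy i (hT'T hi))).trans ?_
        rw [mul_assoc, ← mul_pow]
        refine mul_le_mul_of_nonneg_left (pow_le_pow_left₀ (by positivity) ?_ G) hB0
        have h1 : (i : ℝ) ≤ H := by
          exact_mod_cast (Finset.mem_range.1 (hTH (hT'T hi))).le
        have h2 : (1 : ℝ) ≤ p ^ k := one_le_pow₀ (by exact_mod_cast hp.one_lt.le)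
        push_cast
        have h3 : (0 : ℝ) ≤ s₀ := Nat.cast_nonneg _
        nlinarith
      refine (house_relation_le s y c Δ μ hΔ hμ (hyB c hc) fun i hi => hyB i (hs hi)).trans_lt ?_
      have hpk : (k₀ : ℝ) ≤ p ^ k := by
        have : k₀ ≤ p ^ k := hk.trans (Nat.lt_pow_self hp.one_lt).le
        exact_mod_cast this
      have hpos : (0 : ℝ) < (p ^ k) ^ G := by
        have := hp.pos
        positivity
      rw [hsm]
      push_cast
      calc ((m : ℝ) + 1) * (W * (B * (1 + s₀ + H) ^ G * (p ^ k) ^ G))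
          = ((m : ℝ) + 1) * (W * (B * (1 + s₀ + H) ^ G)) * (p ^ k) ^ G := by ring
        _ < p ^ k * (p ^ k) ^ G := by
            apply mul_lt_mul_of_pos_right (hk₀.trans_le hpk) hpos
        _ = p ^ (k * m) := by rw [pow_mul, pow_succ']
  obtain ⟨s, hsT, hsm⟩ := Finset.exists_subset_card_eq (s := T') (n := m) (by omega)
  let U : N[X] := Lagrange.interpolate s (Nat.cast : ℕ → N) fun i => (y i : N)
  have hU : ∀ c ∈ T', eval (c : N) U = y c := by
    intro c hc
    obtain ⟨Δ, μ, h0, h, h1⟩ := hlin s hsT hsm c hc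
    have h2 := congrArg (algebraMap (𝓞 N) N) h1
    rw [map_mul, map_sum, map_intCast] at h2
    refine interpolate_natCast_eval s (fun i => (y i : N)) c Δ μ h0 h ?_
    rw [h2]
    exact Finset.sum_congr rfl fun i _ => by rw [map_mul, map_intCast]
  have hUm : U.natDegree ≤ m := by
    have := Lagrange.degree_interpolate_lt (s := s) (v := (Nat.cast : ℕ → N))
      (fun i => (y i : N)) Nat.cast_injective.injOn
    rw [hsm] at this
    exact natDegree_le_of_degree_le this.le
  let A : N[X] := C (s₀ : N) + C ((p : N) ^ k) * X
  have hA : A.natDegree ≤ 1 := by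
    simp only [A]; compute_degree
  have hQ0 : eval U ((g.map (mapRingHom (algebraMap (𝓞 N) N))).map (compRingHom A)) = 0 := by
    refine eq_zero_of_natDegree_lt_card_of_eval_eq_zero
      (ι := T') _ (f := fun c => ((c : ℕ) : N)) ?_ (fun c => ?_) ?_
    · exact fun c d hcd => Subtype.ext (Nat.cast_injective hcd)
    · have h1 := hy c (hT'T c.2)
      have h2 := congrArg (algebraMap (𝓞 N) N) h1
      have hc : algebraMap (𝓞 N) N (y c) = eval ((c : ℕ) : N) U := (hU c c.2).symm
      rw [← eval_map_hom, hc, map_zero] at h2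
      rw [← coe_evalRingHom, ← eval_map_hom, coe_evalRingHom, ← h2]
      simp only [Polynomial.map_map]
      congr 2
      ext <;> simp [A]
    · rw [Fintype.card_coe]
      exact (hD U A hUm hA).trans_lt (by omega)
  have hpk : (p : N) ^ k ≠ 0 := pow_ne_zero _ (Nat.cast_ne_zero.2 hp.ne_zero)
  let A' : N[X] := C ((p : N) ^ k)⁻¹ * (X - C (s₀ : N))
  have hAA : A.comp A' = X := by
    simp only [A, A', add_comp, C_comp, mul_comp, X_comp, ← mul_assoc, ← C_mul,
      mul_inv_cancel₀ hpk]
    simp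
  refine hroot (U.comp A') ?_
  have h3 := congrArg (compRingHom A') hQ0
  rw [← eval_map_hom, map_zero, Polynomial.map_map] at h3
  have h4 : (compRingHom A').comp (compRingHom A) = RingHom.id N[X] := by
    ext <;> simp [hAA]
  rwa [h4, Polynomial.map_id] at h3

theorem Sparse.mono {S T : Set ℕ} (hT : Sparse T) (h : S ⊆ T) : Sparse S := by
  obtain ⟨E, hE, hT⟩ := hT
  refine ⟨E, hE, fun s₀ p hp hs => ?_⟩
  obtain ⟨M, hM⟩ := hT s₀ p hp hs
  refine ⟨M, fun H => ?_⟩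
  obtain ⟨k₀, hk⟩ := hM H
  exact ⟨k₀, fun k hk' U hU hUS => hk k hk' U hU fun u hu => h (hUS u hu)⟩

theorem Sparse.empty : Sparse ∅ := by
  refine ⟨fun _ => 1, ⟨0, by simp⟩, fun _ _ _ _ => ⟨0, fun _ => ⟨0, fun _ _ T _ h => ?_⟩⟩⟩
  rw [Nat.le_zero, Finset.card_eq_zero]
  exact Finset.eq_empty_of_forall_notMem fun u hu => h u hu

theorem Sparse.union {S T : Set ℕ} (hS : Sparse S) (hT : Sparse T) : Sparse (S ∪ T) := by
  classical
  obtain ⟨E, ⟨n, hn⟩, hS⟩ := hS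
  obtain ⟨E', ⟨n', hn'⟩, hT⟩ := hT
  refine ⟨fun s => E s * E' s, ⟨max n n', fun s hs =>
    mul_ne_zero (hn s (le_trans (le_max_left _ _) hs)) (hn' s (le_trans (le_max_right _ _) hs))⟩,
    fun s₀ p hp hs => ?_⟩
  obtain ⟨M, hM⟩ := hS s₀ p hp fun h => hs (h.mul_right _)
  obtain ⟨M', hM'⟩ := hT s₀ p hp fun h => hs (h.mul_left _)
  refine ⟨M + M', fun H => ?_⟩
  obtain ⟨k, hk⟩ := hM H
  obtain ⟨k', hk'⟩ := hM' H
  refine ⟨max k k', fun l hl U hU hUS => ?_⟩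
  rw [← Finset.card_filter_add_card_filter_not (s := U) (fun u => s₀ + p ^ l * u ∈ S)]
  refine add_le_add (hk l (le_trans (le_max_left _ _) hl) _ ((Finset.filter_subset _ _).trans hU)
    fun u hu => (Finset.mem_filter.1 hu).2) (hk' l (le_trans (le_max_right _ _) hl) _
      ((Finset.filter_subset _ _).trans hU) fun u hu => ?_)
  obtain ⟨h1, h2⟩ := Finset.mem_filter.1 hu
  exact (hUS u h1).resolve_left h2

theorem Sparse.iUnion_finset {ι : Type*} (I : Finset ι) (S : ι → Set ℕ) (h : ∀ i ∈ I, Sparse (S i)) :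
    Sparse (⋃ i ∈ I, S i) := by
  classical
  induction I using Finset.induction_on with
  | empty => simpa using Sparse.empty
  | insert a s _ ih =>
    rw [Finset.set_biUnion_insert]
    exact (h a (Finset.mem_insert_self a s)).union
      (ih fun i hi => h i (Finset.mem_insert_of_mem hi))

theorem Sparse.exists_gt_notMem {S : Set ℕ} (hS : Sparse S) (n₀ : ℕ) : ∃ t > n₀, t ∉ S := by
  obtain ⟨E, ⟨n, hn⟩, hS⟩ := hS
  let s₀ := max n (n₀ + 1)
  have h0 : E s₀ ≠ 0 := hn _ (le_max_left _ _)
  obtain ⟨p, hp, hprime⟩ := Nat.exists_infinite_primes (E s₀ + 1)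
  obtain ⟨M, hM⟩ := hS s₀ p hprime fun h => by
    have := Nat.le_of_dvd (Nat.pos_of_ne_zero h0) h
    omega
  obtain ⟨k, hk⟩ := hM (M + 1)
  by_contra! hall
  have := hk k le_rfl (Finset.range (M + 1)) subset_rfl fun u _ => hall _ (by
    have : n₀ + 1 ≤ s₀ := le_max_right _ _
    have := Nat.zero_le (p ^ k * u)
    omega)
  rw [Finset.card_range] at this
  omega

theorem Multiset.exists_le_map_eq {α β : Type*} (f : α → β) {s : Multiset α} {t : Multiset β}
    (h : t ≤ s.map f) : ∃ u ≤ s, u.map f = t := by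
  induction s using Quotient.inductionOn with | _ s
  induction t using Quotient.inductionOn with | _ t
  obtain ⟨l, hl, hs⟩ : t.Subperm (s.map f) := by simpa using h
  obtain ⟨l', hl', rfl⟩ := List.sublist_map_iff.1 hs
  exact ⟨l', by simpa using hl'.subperm, by simpa using hl⟩

theorem exists_ringHom_extend {A B K : Type*} [CommRing A] [CommRing B] [Field K] [IsAlgClosed K]
    [Algebra A B] [Algebra.IsIntegral A B] [FaithfulSMul A B] (ψ : A →+* K) :
    ∃ φ : B →+* K, φ.comp (algebraMap A B) = ψ := by
  have : (RingHom.ker ψ).IsPrime := RingHom.ker_isPrime ψ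
  obtain ⟨Q, -, hQ, hQP⟩ := Ideal.exists_ideal_over_prime_of_isIntegral (S := B) (RingHom.ker ψ) ⊥
    (by
      rw [← RingHom.ker_eq_comap_bot, (RingHom.injective_iff_ker_eq_bot _).1
        (FaithfulSMul.algebraMap_injective A B)]
      exact bot_le)
  have : Q.LiesOver (RingHom.ker ψ) := ⟨hQP.symm⟩
  let _ : Algebra (A ⧸ RingHom.ker ψ) K := (RingHom.kerLift ψ).toAlgebra
  have : FaithfulSMul (A ⧸ RingHom.ker ψ) K :=
    (faithfulSMul_iff_algebraMap_injective _ _).2 (RingHom.kerLift_injective ψ)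
  have : IsDomain (A ⧸ RingHom.ker ψ) := Ideal.Quotient.isDomain _
  have : IsDomain (B ⧸ Q) := Ideal.Quotient.isDomain _
  have : Module.IsTorsionFree (A ⧸ RingHom.ker ψ) (B ⧸ Q) :=
    Module.isTorsionFree_iff_faithfulSMul.2 inferInstance
  have : Module.IsTorsionFree (A ⧸ RingHom.ker ψ) K :=
    Module.isTorsionFree_iff_faithfulSMul.2 inferInstance
  let φ : B ⧸ Q →ₐ[A ⧸ RingHom.ker ψ] K := IsAlgClosed.lift
  refine ⟨(φ : B ⧸ Q →+* K).comp (Ideal.Quotient.mk Q), ?_⟩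
  ext a
  have : (φ : B ⧸ Q →+* K) (Ideal.Quotient.mk Q (algebraMap A B a)) =
      φ (algebraMap (A ⧸ RingHom.ker ψ) (B ⧸ Q) (Ideal.Quotient.mk _ a)) := rfl
  simp only [RingHom.comp_apply]
  rw [this, AlgHom.commutes]
  rfl

attribute [local instance] Polynomial.algebra in
theorem no_polynomial_root_of_irreducible {N : Type*} [Field N] [NumberField N] {g : (𝓞 N)[X][X]}
    (hg : g.Monic) (hirr : Irreducible g) (hdeg : g.natDegree ≠ 1) (U : N[X]) :
    eval U (g.map (mapRingHom (algebraMap (𝓞 N) N))) ≠ 0 := by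
  intro h
  have hInt : IsIntegral (𝓞 N)[X] U := ⟨g, hg, by rwa [eval_map] at h⟩
  have hco : ∀ n, U.coeff n ∈ (algebraMap (𝓞 N) N).range := fun n => by
    obtain ⟨x, hx⟩ := IsIntegrallyClosed.isIntegral_iff.1 (hInt.coeff n)
    exact ⟨x, hx⟩
  obtain ⟨V, rfl⟩ := (mem_lifts U).1
    ((lifts_iff_coeff_lifts (f := algebraMap (𝓞 N) N) U).2 fun n => hco n)
  have hinj : Function.Injective (mapRingHom (algebraMap (𝓞 N) N)) :=
    map_injective _ (FaithfulSMul.algebraMap_injective _ _)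
  rw [← coe_mapRingHom, eval_map_hom, map_eq_zero_iff _ hinj] at h
  obtain ⟨q, hq⟩ := dvd_iff_isRoot.2 h
  have hu := (hirr.isUnit_or_isUnit hq).resolve_left (not_isUnit_X_sub_C V)
  have hq1 : q.Monic := (monic_X_sub_C V).of_mul_monic_left (hq ▸ hg)
  rw [hq1.eq_one_of_isUnit hu, mul_one] at hq
  exact hdeg (by rw [hq, natDegree_X_sub_C])

/-- A Bézout identity for a separable polynomial, with denominators cleared. -/
theorem exists_bezout_derivative {A k : Type*} [CommRing A] [IsDomain A] [Field k] [Algebra A k]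
    [IsFractionRing A k] {g : A[X]} (hg : (g.map (algebraMap A k)).Separable) :
    ∃ (a b : A[X]) (e : A), e ≠ 0 ∧ a * g + b * derivative g = C e := by
  obtain ⟨a, b, hab⟩ := hg
  obtain ⟨u, hu, ha⟩ := IsLocalization.integerNormalization_spec (nonZeroDivisors A) a
  obtain ⟨v, hv, hb⟩ := IsLocalization.integerNormalization_spec (nonZeroDivisors A) b
  set a' := IsLocalization.integerNormalization (nonZeroDivisors A) a
  set b' := IsLocalization.integerNormalization (nonZeroDivisors A) b
  refine ⟨C v * a', C u * b', u * v, nonZeroDivisors.ne_zero (mul_mem hu hv), ?_⟩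
  apply map_injective _ (IsFractionRing.injective A k)
  simp only [Polynomial.map_add, Polynomial.map_mul, map_C, ha, hb, ← derivative_map]
  have e1 : ∀ (u : A) (P : k[X]), u • P = C (algebraMap A k u) * P := fun u P => by
    rw [← smul_eq_C_mul, algebraMap_smul]
  rw [e1, e1, map_mul, C_mul]
  linear_combination (C (algebraMap A k u) * C (algebraMap A k v)) * hab

theorem sparse_minpoly_root {N : Type*} [Field N] [NumberField N] {R : Type*} [CommRing R]
    [IsDomain R] [Algebra (𝓞 N)[X] R] [FaithfulSMul (𝓞 N)[X] R] {z : R}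
    (hz : IsIntegral (𝓞 N)[X] z) (hzr : z ∉ (algebraMap (𝓞 N)[X] R).range) :
    Sparse {s | ∃ y : 𝓞 N, eval y ((minpoly (𝓞 N)[X] z).map (evalRingHom (s : 𝓞 N))) = 0} := by
  have hm := minpoly.monic hz
  have hirr := minpoly.irreducible hz
  let k := FractionRing (𝓞 N)[X]
  have : CharZero k := charZero_of_injective_algebraMap (IsFractionRing.injective (𝓞 N)[X] k)
  have hk : Irreducible ((minpoly (𝓞 N)[X] z).map (algebraMap _ k)) :=
    hm.irreducible_iff_irreducible_map_fraction_map.1 hirr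
  obtain ⟨a, b, e, he, hab⟩ := exists_bezout_derivative hk.separable
  refine sparse_root hm he hab (no_polynomial_root_of_irreducible hm hirr fun h => hzr ?_)
  refine minpoly.mem_range_of_degree_eq_one _ _ ?_
  rw [degree_eq_natDegree hm.ne_zero, h]; rfl

theorem exists_integral_roots {A k : Type*} [CommRing A] [Field k] [IsAlgClosed k]
    [Algebra A k] {f : A[X]} (hf : f.Monic) :
    ∃ r : Multiset (integralClosure A k),
      f.map (algebraMap A (integralClosure A k)) = (r.map fun x => X - C x).prod := by
  let f' := f.map (algebraMap A k)
  have hInt : ∀ x ∈ f'.roots, x ∈ integralClosure A k := by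
    intro x hx
    refine ⟨f, hf, ?_⟩
    have := (mem_roots'.1 hx).2
    rwa [IsRoot, eval_map] at this
  refine ⟨f'.roots.pmap (fun x hx => ⟨x, hx⟩) hInt, ?_⟩
  apply map_injective (algebraMap (integralClosure A k) k) Subtype.val_injective
  rw [Polynomial.map_map, ← IsScalarTower.algebraMap_eq, Polynomial.map_multiset_prod,
    Multiset.map_map, Multiset.map_pmap]
  have h := (IsAlgClosed.splits f').eq_prod_roots
  rw [(hf.map (algebraMap A k)).leadingCoeff, C_1, one_mul] at h
  refine h.trans ?_
  rw [← Multiset.pmap_eq_map (p := fun x => x ∈ integralClosure A k) _ _ hInt]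
  congr 1
  refine Multiset.pmap_congr _ fun _ _ _ _ => ?_
  simp

theorem sparse_not_irreducible_integral {N : Type*} [Field N] [NumberField N] {f : (𝓞 N)[X][X]}
    (hf : f.Monic) (hirr : Irreducible f) :
    Sparse {s | ¬ Irreducible ((f.map (evalRingHom (s : 𝓞 N))).map (algebraMap (𝓞 N) N))} := by
  classical
  let Ω := AlgebraicClosure (FractionRing (𝓞 N)[X])
  let R := integralClosure (𝓞 N)[X] Ω
  have hinjΩ : Function.Injective (algebraMap (𝓞 N)[X] Ω) := by
    rw [IsScalarTower.algebraMap_eq (𝓞 N)[X] (FractionRing (𝓞 N)[X]) Ω]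
    exact (algebraMap (FractionRing (𝓞 N)[X]) Ω).injective.comp (IsFractionRing.injective _ _)
  have : FaithfulSMul (𝓞 N)[X] R := (faithfulSMul_iff_algebraMap_injective _ _).2 fun x y h =>
    hinjΩ (congrArg Subtype.val h)
  have hinj : Function.Injective (algebraMap (𝓞 N)[X] R) := FaithfulSMul.algebraMap_injective _ _
  obtain ⟨r, hr⟩ := exists_integral_roots (k := Ω) hf
  have hR : f.map (algebraMap (𝓞 N)[X] R) = (r.map fun x => X - C x).prod := hr
  clear hr
  let u : Multiset R → R[X] := fun J => (J.map fun x => X - C x).prod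
  let Z : Finset R := (r.powerset.toFinset.biUnion fun J => (u J).coeffs).filter
    fun z => z ∉ (algebraMap (𝓞 N)[X] R).range
  refine (Sparse.iUnion_finset Z
    (fun z => {s | ∃ y : 𝓞 N, eval y ((minpoly (𝓞 N)[X] z).map (evalRingHom (s : 𝓞 N))) = 0})
    fun z hz => sparse_minpoly_root (Algebra.IsIntegral.isIntegral z)
      (Finset.mem_filter.1 hz).2).mono ?_
  intro s hs
  have hfs : ((f.map (evalRingHom (s : 𝓞 N))).map (algebraMap (𝓞 N) N)).Monic :=
    (hf.map _).map _
  have hdeg : ((f.map (evalRingHom (s : 𝓞 N))).map (algebraMap (𝓞 N) N)).natDegree =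
      f.natDegree := by rw [(hf.map _).natDegree_map, hf.natDegree_map]
  have hpos : 0 < f.natDegree := hf.natDegree_pos_of_not_isUnit hirr.not_isUnit
  have h1 : ((f.map (evalRingHom (s : 𝓞 N))).map (algebraMap (𝓞 N) N)) ≠ 1 := fun h => by
    rw [h, natDegree_one] at hdeg
    omega
  rw [Set.mem_ofPred_eq, hfs.irreducible_iff_natDegree'] at hs
  simp only [h1, ne_eq, not_false_eq_true, true_and, not_forall, not_not] at hs
  obtain ⟨w, v, hw, hv, hwv, hvd⟩ := hs
  rw [hdeg, Finset.mem_Ioc] at hvd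
  let K := AlgebraicClosure N
  let ψ : (𝓞 N)[X] →+* K :=
    ((algebraMap N K).comp (algebraMap (𝓞 N) N)).comp (evalRingHom (s : 𝓞 N))
  obtain ⟨φ, hφ⟩ := exists_ringHom_extend (B := R) ψ
  have hfψ : f.map ψ = ((r.map φ).map fun x => X - C x).prod := by
    rw [← hφ, ← Polynomial.map_map, hR, Polynomial.map_multiset_prod, Multiset.map_map,
      Multiset.map_map]
    simp
    rfl
  have hvf : (v.map (algebraMap N K)).roots ≤ r.map φ := by
    rw [← roots_multiset_prod_X_sub_C (r.map φ), ← hfψ]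
    refine roots.le_of_dvd (hf.map _).ne_zero ?_
    have := Polynomial.map_dvd (algebraMap N K) (Dvd.intro_left _ hwv)
    rwa [Polynomial.map_map, Polynomial.map_map] at this
  obtain ⟨J, hJ, hJv⟩ := Multiset.exists_le_map_eq φ hvf
  have hv' : (u J).map φ = v.map (algebraMap N K) := by
    have h := (IsAlgClosed.splits (v.map (algebraMap N K))).eq_prod_roots
    rw [(hv.map (algebraMap N K)).leadingCoeff, C_1, one_mul, ← hJv] at h
    rw [h, Polynomial.map_multiset_prod, Multiset.map_map, Multiset.map_map]
    simp
  have huJ : (u J).Monic := monic_multiset_prod_of_monic _ _ fun x _ => monic_X_sub_C x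
  have hud : (u J).natDegree = v.natDegree := by
    rw [← huJ.natDegree_map φ, hv', hv.natDegree_map]
  have hlift : u J ∉ lifts (algebraMap (𝓞 N)[X] R) := by
    intro h
    obtain ⟨q, hq, hqd, hqm⟩ := lifts_and_natDegree_eq_and_monic h huJ
    have hdvd : q ∣ f := by
      rw [← map_dvd_map _ hinj hqm, hq, hR]
      exact Multiset.prod_dvd_prod_of_le (Multiset.map_le_map hJ)
    obtain ⟨q', hq'⟩ := hdvd
    have hq'm : q'.Monic := hqm.of_mul_monic_left (hq' ▸ hf)
    have hd : f.natDegree = q.natDegree + q'.natDegree := by rw [hq', hqm.natDegree_mul hq'm]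
    rcases hirr.isUnit_or_isUnit hq' with hu | hu
    · rw [hqm.eq_one_of_isUnit hu, natDegree_one] at hqd
      omega
    · rw [hq'm.eq_one_of_isUnit hu, natDegree_one] at hd
      omega
  rw [lifts_iff_coeff_lifts] at hlift
  push Not at hlift
  obtain ⟨i, hi⟩ := hlift
  have hiZ : (u J).coeff i ∈ Z := by
    refine Finset.mem_filter.2 ⟨Finset.mem_biUnion.2 ⟨J, by simpa using hJ, ?_⟩, hi⟩
    refine coeff_mem_coeffs fun h => hi ⟨0, by rw [h, map_zero]⟩
  refine Set.mem_iUnion₂.2 ⟨_, hiZ, ?_⟩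
  have hroot : eval (v.coeff i) (((minpoly (𝓞 N)[X] ((u J).coeff i)).map
      (evalRingHom (s : 𝓞 N))).map (algebraMap (𝓞 N) N)) = 0 := by
    apply (algebraMap N K).injective
    rw [← eval_map_hom, map_zero, ← coeff_map, ← hv', coeff_map, Polynomial.map_map,
      Polynomial.map_map]
    change eval _ (Polynomial.map ψ _) = 0
    rw [← hφ, ← Polynomial.map_map, eval_map_hom]
    have := minpoly.aeval (𝓞 N)[X] ((u J).coeff i)
    rw [aeval_def, ← eval_map] at this
    rw [this, map_zero]
  have hInt : IsIntegral (𝓞 N) (v.coeff i) :=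
    ⟨_, (minpoly.monic (Algebra.IsIntegral.isIntegral _)).map _, by rwa [eval_map] at hroot⟩
  obtain ⟨y, hy⟩ := IsIntegrallyClosed.isIntegral_iff.1 hInt
  refine ⟨y, ?_⟩
  rw [← hy, eval_map_hom] at hroot
  exact (map_eq_zero_iff _ (FaithfulSMul.algebraMap_injective (𝓞 N) N)).1 hroot

theorem Polynomial.Monic.irreducible_scaleRoots {R : Type*} [CommRing R] [IsDomain R] {p : R[X]}
    (hp : p.Monic) {r s : R} (hrs : r * s = 1) (h : Irreducible p) :
    Irreducible (p.scaleRoots r) := by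
  rw [((monic_scaleRoots_iff r).2 hp).irreducible_iff_natDegree]
  refine ⟨fun h1 => ?_, fun a b ha hb hab => ?_⟩
  · have h2 : p.natDegree = 0 := by rw [← natDegree_scaleRoots p r, h1, natDegree_one]
    exact h.not_isUnit (by rw [hp.natDegree_eq_zero.1 h2]; exact isUnit_one)
  · have h3 : a.scaleRoots s * b.scaleRoots s = p := by
      rw [← mul_scaleRoots_of_noZeroDivisors, hab, ← scaleRoots_mul, hrs, scaleRoots_one]
    have := (hp.irreducible_iff_natDegree.1 h).2 _ _ ((monic_scaleRoots_iff s).2 ha)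
      ((monic_scaleRoots_iff s).2 hb) h3
    simpa using this

theorem exists_integer_multiple_lifts {N : Type*} [Field N] [NumberField N] (f : N[X][X])
    (hf : f.Monic) : ∃ d : N, d ≠ 0 ∧ ∃ g : (𝓞 N)[X][X], g.Monic ∧
      g.map (mapRingHom (algebraMap (𝓞 N) N)) = f.scaleRoots (C d) := by
  classical
  obtain ⟨b, hb⟩ := IsLocalization.exist_integer_multiples_of_finset (nonZeroDivisors (𝓞 N))
    (f.coeffs.biUnion fun c => c.coeffs)
  have hc : ∀ i j, ∃ x : 𝓞 N, algebraMap (𝓞 N) N x = algebraMap (𝓞 N) N b * (f.coeff i).coeff j := by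
    intro i j
    by_cases h0 : (f.coeff i).coeff j = 0
    · exact ⟨0, by rw [h0, map_zero, mul_zero]⟩
    · have hi : f.coeff i ≠ 0 := fun h => h0 (by rw [h, coeff_zero])
      obtain ⟨x, hx⟩ := hb ((f.coeff i).coeff j)
        (Finset.mem_biUnion.2 ⟨_, coeff_mem_coeffs hi, coeff_mem_coeffs h0⟩)
      exact ⟨x, by rw [hx, Algebra.smul_def]⟩
  refine ⟨algebraMap (𝓞 N) N b, fun h => ?_, ?_⟩
  · exact nonZeroDivisors.ne_zero b.2 ((map_eq_zero_iff _ (FaithfulSMul.algebraMap_injective _ _)).1 h)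
  · have hl : f.scaleRoots (C (algebraMap (𝓞 N) N b)) ∈
        lifts (mapRingHom (algebraMap (𝓞 N) N)) := by
      rw [lifts_iff_coeff_lifts]
      intro i
      rw [coeff_scaleRoots]
      rcases lt_trichotomy i f.natDegree with h | h | h
      · obtain ⟨m, hm⟩ : ∃ m, f.natDegree - i = m + 1 := ⟨f.natDegree - i - 1, by omega⟩
        rw [hm, pow_succ', ← mul_assoc]
        have hx : f.coeff i * C (algebraMap (𝓞 N) N b) ∈ lifts (algebraMap (𝓞 N) N) := by
          rw [lifts_iff_coeff_lifts]
          intro j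
          obtain ⟨x, hx⟩ := hc i j
          exact ⟨x, by rw [coeff_mul_C, mul_comm, hx]⟩
        obtain ⟨y, hy⟩ := (mem_lifts _).1 hx
        refine ⟨y * C (b : 𝓞 N) ^ m, ?_⟩
        rw [map_mul, map_pow, coe_mapRingHom, hy, map_C]
      · subst h
        exact ⟨1, by rw [coeff_natDegree, hf.leadingCoeff, Nat.sub_self]; simp⟩
      · exact ⟨0, by rw [coeff_eq_zero_of_natDegree_lt h, zero_mul, map_zero]⟩
    obtain ⟨g, hg, -, hgm⟩ := lifts_and_natDegree_eq_and_monic hl ((monic_scaleRoots_iff _).2 hf)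
    exact ⟨g, hgm, hg⟩

theorem sparse_not_irreducible {N : Type*} [Field N] [NumberField N] {f : N[X][X]}
    (hf : f.Monic) (hirr : Irreducible f) :
    Sparse {s | ¬ Irreducible (f.map (evalRingHom (s : N)))} := by
  obtain ⟨d, hd, g, hg, hgf⟩ := exists_integer_multiple_lifts f hf
  have hu : (C d : N[X]) * C d⁻¹ = 1 := by rw [← C_mul, mul_inv_cancel₀ hd, C_1]
  have h1 : Irreducible (g.map (mapRingHom (algebraMap (𝓞 N) N))) := by
    rw [hgf]
    exact hf.irreducible_scaleRoots hu hirr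
  have h2 : Irreducible g := hg.irreducible_of_irreducible_map _ g h1
  refine (sparse_not_irreducible_integral hg h2).mono ?_
  intro s hs h
  apply hs
  have h3 : (g.map (evalRingHom (s : 𝓞 N))).map (algebraMap (𝓞 N) N) =
      (f.map (evalRingHom (s : N))).scaleRoots d := by
    have : (f.map (evalRingHom (s : N))).scaleRoots d =
        (f.scaleRoots (C d)).map (evalRingHom (s : N)) := by
      rw [map_scaleRoots _ _ _ (by rw [hf.leadingCoeff, map_one]; exact one_ne_zero)]
      simp
    rw [this, ← hgf, Polynomial.map_map, Polynomial.map_map]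
    congr 1
    ext <;> simp
  rw [h3] at h
  have h4 := ((monic_scaleRoots_iff d).2 (hf.map (evalRingHom (s : N)))).irreducible_scaleRoots
    (inv_mul_cancel₀ hd) h
  rwa [← scaleRoots_mul, mul_inv_cancel₀ hd, scaleRoots_one] at h4

theorem isNowhereDense_of_forall_mem {X : Type*} [TopologicalSpace X] {B : Set X}
    (h : ∀ x ∈ B, ∀ U, IsOpen U → x ∈ U → ∃ V ⊆ U, IsOpen V ∧ V.Nonempty ∧ Disjoint V B) :
    IsNowhereDense B := by
  rw [IsNowhereDense, Set.eq_empty_iff_forall_notMem]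
  intro y hy
  obtain ⟨x, hxU, hxB⟩ := mem_closure_iff.1 (interior_subset hy) _ isOpen_interior hy
  obtain ⟨V, hVU, hV, ⟨z, hz⟩, hVB⟩ := h x hxB _ isOpen_interior hxU
  obtain ⟨w, hwV, hwB⟩ := mem_closure_iff.1 (interior_subset (hVU hz)) _ hV hz
  exact Set.disjoint_left.1 hVB hwV hwB

theorem IsNowhereDense.biUnion_finite {X ι : Type*} [TopologicalSpace X] {I : Set ι} (hI : I.Finite)
    {B : ι → Set X} (h : ∀ i ∈ I, IsNowhereDense (B i)) : IsNowhereDense (⋃ i ∈ I, B i) := by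
  induction I, hI using Set.Finite.induction_on with
  | empty => simp [isNowhereDense_empty]
  | insert _ _ ih =>
    rw [Set.biUnion_insert, IsNowhereDense, closure_union,
      interior_union_isClosed_of_interior_empty isClosed_closure
        (ih fun i hi => h i (Set.mem_insert_of_mem _ hi))]
    exact h _ (Set.mem_insert _ _)

theorem isOpen_agree (S : Finset Qbar) (F₀ : Subfield Qbar) :
    IsOpen {F : Subfield Qbar | ∀ a ∈ S, a ∈ F ↔ a ∈ F₀} := by
  let _ := propDiscrete
  have : DiscreteTopology Prop := ⟨rfl⟩
  have : {F : Subfield Qbar | ∀ a ∈ S, a ∈ F ↔ a ∈ F₀} = ⋂ a ∈ S, {F | a ∈ F ↔ a ∈ F₀} := by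
    ext; simp
  rw [this]
  refine isOpen_biInter_finset fun a _ => ?_
  have hc : Continuous fun F : Subfield Qbar => (a ∈ F : Prop) := by
    have h1 : @Continuous _ _ subfieldTopology powersetTopology
      (fun F : Subfield Qbar => (F : Set Qbar)) := continuous_induced_dom
    have h2 : @Continuous _ _ powersetTopology propDiscrete (fun s : Set Qbar => a ∈ s) :=
      @continuous_apply Qbar (fun _ => Prop) (fun _ => propDiscrete) a
    exact @Continuous.comp _ _ _ _ powersetTopology _ _ _ h2 h1
  exact (isOpen_discrete {p : Prop | p ↔ a ∈ F₀}).preimage hc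

theorem exists_agree_subset {U : Set (Subfield Qbar)} (hU : IsOpen U) {F₀ : Subfield Qbar}
    (hF : F₀ ∈ U) : ∃ S : Finset Qbar, {F : Subfield Qbar | ∀ a ∈ S, a ∈ F ↔ a ∈ F₀} ⊆ U := by
  obtain ⟨V, hV, rfl⟩ := hU
  obtain ⟨S, u, hu, hS⟩ :=
    (@isOpen_pi_iff Qbar (fun _ => Prop) (fun _ => propDiscrete) V).1 hV _ hF
  refine ⟨S, fun F hF' => hS fun a ha => ?_⟩
  have : ((F : Set Qbar) : Qbar → Prop) a = ((F₀ : Set Qbar) : Qbar → Prop) a :=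
    propext (hF' a ha)
  exact (congrArg (· ∈ u a) this).mpr (hu a ha).2

theorem exists_finset_agree (N : IntermediateField ℚ Qbar) [FiniteDimensional ℚ N] :
    ∃ T : Finset Qbar, ∀ F₁ F₂ : Subfield Qbar, (∀ a ∈ T, a ∈ F₁ ↔ a ∈ F₂) →
      ∀ y ∈ N, y ∈ F₁ ↔ y ∈ F₂ := by
  classical
  have : Finite (IntermediateField ℚ N) :=
    (Field.exists_primitive_element_iff_finite_intermediateField ℚ N).1
      ⟨inferInstance, Field.exists_primitive_element ℚ N⟩ 
  have := Fintype.ofFinite (IntermediateField ℚ N)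
  choose p hp using fun M : IntermediateField ℚ N => Field.exists_primitive_element ℚ M
  refine ⟨Finset.univ.image fun M => ((p M : N) : Qbar), ?_⟩
  have key : ∀ F₁ F₂ : Subfield Qbar,
      (∀ a ∈ Finset.univ.image fun M => ((p M : N) : Qbar), a ∈ F₁ ↔ a ∈ F₂) →
      ∀ y ∈ N, y ∈ F₁ → y ∈ F₂ := by
    intro F₁ F₂ h y hy hy1
    let M : IntermediateField ℚ N := (F₁.toIntermediateField fun x => by simp).comap N.val
    have h1 : ((p M : N) : Qbar) ∈ F₂ :=
      (h _ (Finset.mem_image_of_mem _ (Finset.mem_univ M))).1 (p M).2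
    let M₂ : IntermediateField ℚ M :=
      ((F₂.toIntermediateField fun x => by simp).comap N.val).comap M.val
    have h2 : M₂ = ⊤ := by
      rw [eq_top_iff, ← hp M]
      exact IntermediateField.adjoin_simple_le_iff.2 h1
    have h3 : (⟨⟨y, hy⟩, hy1⟩ : M) ∈ M₂ := h2 ▸ IntermediateField.mem_top
    exact h3
  exact fun F₁ F₂ h y hy => ⟨key _ _ h y hy, key _ _ (fun a ha => (h a ha).symm) y hy⟩

end

section
open Polynomial NumberField IntermediateField

theorem natDegree_minpoly_le_finrank_mul {k Ω : Type*} [Field k] [Field Ω] [Algebra k Ω]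
    (L : IntermediateField k Ω) [FiniteDimensional k L] {z : Ω} (hz : IsIntegral k z) :
    (minpoly k z).natDegree ≤ Module.finrank k L * (minpoly L z).natDegree := by
  have hzL : IsIntegral L z := hz.tower_top
  have h1 : (minpoly L z).natDegree = Module.finrank L L⟮z⟯ := (adjoin.finrank hzL).symm
  have : FiniteDimensional L L⟮z⟯ := adjoin.finiteDimensional hzL
  have : FiniteDimensional k L⟮z⟯ := FiniteDimensional.trans k L L⟮z⟯
  have : Module.Free L L⟮z⟯ := Module.Free.of_divisionRing L L⟮z⟯
  have : Module.Free k L := Module.Free.of_divisionRing k L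
  have : IsScalarTower k L⟮z⟯ Ω := .of_algebraMap_eq fun _ => rfl
  rw [h1, Module.finrank_mul_finrank k L L⟮z⟯]
  have h2 := minpoly.natDegree_le (A := k) (AdjoinSimple.gen L z)
  rwa [← minpoly.algebraMap_eq (algebraMap L⟮z⟯ Ω).injective, AdjoinSimple.algebraMap_gen] at h2

theorem natDegree_le_of_dvd_irreducible {k Ω : Type*} [Field k] [Field Ω] [Algebra k Ω]
    [IsAlgClosed Ω] (L : IntermediateField k Ω) [FiniteDimensional k L] {g : k[X]} (hg : g.Monic)
    (hirr : Irreducible g) {u : L[X]} (hu : 0 < u.natDegree)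
    (hug : u.map (algebraMap L Ω) ∣ g.map (algebraMap k Ω)) :
    g.natDegree ≤ Module.finrank k L * u.natDegree := by
  obtain ⟨z, hz⟩ := IsAlgClosed.exists_aeval_eq_zero Ω u (by
    rw [degree_eq_natDegree (ne_zero_of_natDegree_gt hu)]
    exact_mod_cast hu.ne')
  have hzg : aeval z g = 0 := by
    rw [aeval_def, ← eval_map] at hz ⊢
    exact eval_eq_zero_of_dvd_of_eval_eq_zero hug hz
  have hmin := minpoly.eq_of_irreducible_of_monic hirr hzg hg
  rw [hmin]
  refine (natDegree_minpoly_le_finrank_mul L ⟨g, hg, by rwa [aeval_def] at hzg⟩).trans ?_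
  exact Nat.mul_le_mul_left _
    (natDegree_le_of_dvd (minpoly.dvd L z hz) (ne_zero_of_natDegree_gt hu))

theorem exists_good_specialization {L N Ω : Type*} [Field L] [NumberField L] [Field N]
    [NumberField N] [Field Ω] [IsAlgClosed Ω] [Algebra L N] [Algebra N Ω] [Algebra L Ω]
    [IsScalarTower L N Ω] {f h : L[X][X]} (hf : f.Monic)
    (hfirr : Irreducible (f.map (mapRingHom (algebraMap L N)))) (hh : h.Monic)
    (hhirr : Irreducible h) (n₀ : ℕ) :
    ∃ t > n₀, ∃ x : Ω, IsIntegral L x ∧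
      eval x ((f.map (evalRingHom (t : L))).map (algebraMap L Ω)) = 0 ∧
      (∀ y : N, algebraMap N Ω y ∈ L⟮x⟯ → y ∈ (algebraMap L N).range) ∧
      (1 < f.natDegree → x ∉ (algebraMap N Ω).range) ∧
      ∀ u : L⟮x⟯[X], 0 < u.natDegree →
        u.map (algebraMap L⟮x⟯ Ω) ∣ (h.map (evalRingHom (t : L))).map (algebraMap L Ω) →
        h.natDegree ≤ f.natDegree * u.natDegree := by
  obtain ⟨t, ht, hts⟩ := ((sparse_not_irreducible (hf.map _) hfirr).union
    (sparse_not_irreducible hh hhirr)).exists_gt_notMem n₀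
  simp only [Set.mem_union, Set.mem_ofPred_eq, not_or, not_not] at hts
  obtain ⟨h1, h2⟩ := hts
  set g := f.map (evalRingHom (t : L)) with hg
  have hgm : g.Monic := hf.map _
  have hgN : (f.map (mapRingHom (algebraMap L N))).map (evalRingHom (t : N)) =
      g.map (algebraMap L N) := by
    rw [hg, Polynomial.map_map, Polynomial.map_map]
    congr 1
    ext <;> simp
  rw [hgN] at h1
  have hgi : Irreducible g := hgm.irreducible_of_irreducible_map _ g h1
  have hgd : g.natDegree = f.natDegree := hf.natDegree_map _
  have hpos : 0 < g.natDegree := hgi.natDegree_pos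
  obtain ⟨x, hx⟩ := IsAlgClosed.exists_aeval_eq_zero Ω g (by
    rw [degree_eq_natDegree hgm.ne_zero]; exact_mod_cast hpos.ne')
  have hInt : IsIntegral L x := ⟨g, hgm, by rwa [aeval_def] at hx⟩
  have hxN : aeval x (g.map (algebraMap L N)) = 0 := by rw [aeval_map_algebraMap, hx]
  have hminN := minpoly.eq_of_irreducible_of_monic h1 hxN (hgm.map _)
  have hmin := minpoly.eq_of_irreducible_of_monic hgi hx hgm
  have : FiniteDimensional L L⟮x⟯ := adjoin.finiteDimensional hInt
  have hfr : Module.finrank L L⟮x⟯ = f.natDegree := by rw [adjoin.finrank hInt, ← hmin, hgd]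
  refine ⟨t, ht, x, hInt, by rwa [eval_map, ← aeval_def], ?_, ?_, ?_⟩
  · intro y hy
    have hy' : algebraMap N Ω y ∈ L⟮x⟯.toSubalgebra := hy
    rw [adjoin_simple_toSubalgebra_of_isAlgebraic hInt.isAlgebraic,
      Algebra.adjoin_singleton_eq_range_aeval] at hy'
    obtain ⟨q, hq⟩ := hy'
    have hq' : aeval x q = algebraMap N Ω y := hq
    rw [← aeval_modByMonic_eq_self_of_root hx] at hq'
    set p := q %ₘ g
    have hp : p.degree < g.degree := degree_modByMonic_lt _ hgm
    have hP : p.map (algebraMap L N) - C y = 0 := by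
      by_contra hne
      have hd := minpoly.degree_le_of_ne_zero N x hne (by
        rw [map_sub, aeval_map_algebraMap, hq', aeval_C, sub_self])
      rw [← hminN, degree_map] at hd
      refine absurd hd (not_le.2 ((degree_sub_le _ _).trans_lt (max_lt ?_ ?_)))
      · rwa [degree_map]
      · refine degree_C_le.trans_lt ?_
        rw [degree_eq_natDegree hgm.ne_zero]
        exact_mod_cast hpos
    refine ⟨p.coeff 0, ?_⟩
    have := congrArg (fun P => coeff P 0) hP
    simpa [sub_eq_zero] using this
  · intro hd hxr
    have := minpoly.degree_eq_one_iff.2 hxr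
    rw [← hminN, degree_map, degree_eq_natDegree hgm.ne_zero, hgd] at this
    have : f.natDegree = 1 := by exact_mod_cast this
    omega
  · intro u hu hud
    have := natDegree_le_of_dvd_irreducible L⟮x⟯ (hh.map _) h2 hu hud
    rwa [hfr, hh.natDegree_map] at this

theorem Polynomial.Monic.exists_monic_lift {A B : Type*} [CommRing A] [CommRing B] [Nontrivial B]
    (φ : A →+* B) {P : B[X][X]} (hP : P.Monic) (h : ∀ i j, (P.coeff i).coeff j ∈ φ.range) :
    ∃ g : A[X][X], g.Monic ∧ g.map (mapRingHom φ) = P := by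
  have : P ∈ lifts (mapRingHom φ) := by
    rw [lifts_iff_coeff_lifts]
    intro i
    obtain ⟨q, hq⟩ := (mem_lifts _).1 ((lifts_iff_coeff_lifts (f := φ) (P.coeff i)).2 (h i))
    exact ⟨q, hq⟩
  obtain ⟨g, hg, -, hgm⟩ := lifts_and_natDegree_eq_and_monic this hP
  exact ⟨g, hgm, hg⟩

/-- The natural number `t` yields a root of `f(t, X)` in `F` while `h(t, X)` has no monic factor of
small degree over `F`. -/
def IsGoodSpecialization (F : Subfield Qbar) (f h : Qbar[X][X]) (t : ℕ) : Prop :=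
  (∃ x ∈ F, eval x (f.map (evalRingHom (t : Qbar))) = 0) ∧
    ∀ u : F[X], u.Monic → 0 < u.natDegree →
      u.map F.subtype ∣ h.map (evalRingHom (t : Qbar)) →
      h.natDegree ≤ f.natDegree * u.natDegree

/-- The subfields `F` over which `f` is defined and geometrically irreducible and `h` is defined
and irreducible, without good specializations beyond `n₀`. -/
def badSet (f h : Qbar[X][X]) (n₀ : ℕ) : Set (Subfield Qbar) :=
  {F | (∃ g k : F[X][X], g.map (mapRingHom F.subtype) = f ∧ k.map (mapRingHom F.subtype) = h ∧
      g.Monic ∧ k.Monic ∧ Irreducible k) ∧ Irreducible f ∧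
      ∀ t > n₀, ¬ IsGoodSpecialization F f h t}

instance isAlgebraic_qbar : Algebra.IsAlgebraic ℚ Qbar := AlgebraicClosure.isAlgebraic ℚ

theorem finiteDimensional_adjoin_finset (S : Finset Qbar) :
    FiniteDimensional ℚ (adjoin ℚ (S : Set Qbar)) :=
  finiteDimensional_adjoin fun x _ => Algebra.IsIntegral.isIntegral x

theorem exists_agree_isGoodSpecialization {F₀ : Subfield Qbar} {f h : F₀[X][X]} (hf : f.Monic)
    (hfirr : Irreducible (f.map (mapRingHom F₀.subtype))) (hh : h.Monic) (hhirr : Irreducible h)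
    (S : Finset Qbar) (n₀ : ℕ) :
    ∃ (F₁ : Subfield Qbar) (T : Finset Qbar), (∀ a ∈ S, a ∈ F₁ ↔ a ∈ F₀) ∧
      (1 < f.natDegree → ¬ F₁ ≤ (adjoin ℚ (S : Set Qbar)).toSubfield) ∧
      ∃ t > n₀, ∀ F : Subfield Qbar, (∀ a ∈ T, a ∈ F ↔ a ∈ F₁) →
        (∀ a ∈ S, a ∈ F ↔ a ∈ F₁) ∧
        IsGoodSpecialization F (f.map (mapRingHom F₀.subtype)) (h.map (mapRingHom F₀.subtype)) t := by
  classical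
  set f' := f.map (mapRingHom F₀.subtype) with hf'
  set h' := h.map (mapRingHom F₀.subtype) with hh'
  let C : Finset Qbar := S ∪ (f'.coeffs ∪ h'.coeffs).biUnion fun c => c.coeffs
  let N : IntermediateField ℚ Qbar := adjoin ℚ (C : Set Qbar)
  have := finiteDimensional_adjoin_finset C
  let F₀' : IntermediateField ℚ Qbar := F₀.toIntermediateField fun x => by simp
  let L : IntermediateField ℚ Qbar := F₀' ⊓ N
  have hCN : ∀ a ∈ C, a ∈ N := fun a ha => subset_adjoin ℚ _ ha
  let _ : Algebra L N := (inclusion (inf_le_right : L ≤ N)).toAlgebra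
  have : IsScalarTower L N Qbar := .of_algebraMap_eq fun _ => rfl
  have : FiniteDimensional ℚ L :=
    Module.Finite.of_injective (inclusion (inf_le_right : L ≤ N)).toLinearMap
      (inclusion (inf_le_right : L ≤ N)).injective
  have : NumberField L := ⟨⟩
  have : NumberField N := ⟨⟩
  have hcf : ∀ i j, (f'.coeff i).coeff j ∈ C ∪ {0} := by
    intro i j
    by_cases h0 : (f'.coeff i).coeff j = 0
    · simp [h0]
    · have hi : f'.coeff i ≠ 0 := fun h => h0 (by rw [h, coeff_zero])
      exact Finset.mem_union_left _ (Finset.mem_union_right _ (Finset.mem_biUnion.2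
        ⟨_, Finset.mem_union_left _ (coeff_mem_coeffs hi), coeff_mem_coeffs h0⟩))
  have hch : ∀ i j, (h'.coeff i).coeff j ∈ C ∪ {0} := by
    intro i j
    by_cases h0 : (h'.coeff i).coeff j = 0
    · simp [h0]
    · have hi : h'.coeff i ≠ 0 := fun h => h0 (by rw [h, coeff_zero])
      exact Finset.mem_union_left _ (Finset.mem_union_right _ (Finset.mem_biUnion.2
        ⟨_, Finset.mem_union_right _ (coeff_mem_coeffs hi), coeff_mem_coeffs h0⟩))
  have hC0 : ∀ a ∈ C ∪ {0}, a ∈ N := by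
    intro a ha
    rcases Finset.mem_union.1 ha with ha | ha
    · exact hCN a ha
    · rw [Finset.mem_singleton.1 ha]
      exact zero_mem N
  let ρ : L →+* F₀ := Subring.inclusion (S := L.toSubring) (T := F₀.toSubring)
    fun x hx => hx.1
  obtain ⟨fL, hfLm, hfL⟩ := hf.exists_monic_lift ρ fun i j => by
    have : (f'.coeff i).coeff j = ((f.coeff i).coeff j : Qbar) := by simp [hf']
    exact ⟨⟨(f.coeff i).coeff j, ((f.coeff i).coeff j).2, this ▸ hC0 _ (hcf i j)⟩, rfl⟩
  obtain ⟨hL, hhLm, hhL⟩ := hh.exists_monic_lift ρ fun i j => by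
    have : (h'.coeff i).coeff j = ((h.coeff i).coeff j : Qbar) := by simp [hh']
    exact ⟨⟨(h.coeff i).coeff j, ((h.coeff i).coeff j).2, this ▸ hC0 _ (hch i j)⟩, rfl⟩
  have hfL' : fL.map (mapRingHom (algebraMap L Qbar)) = f' := by
    rw [hf', ← hfL, Polynomial.map_map, mapRingHom_comp]
    rfl
  have hhL' : hL.map (mapRingHom (algebraMap L Qbar)) = h' := by
    rw [hh', ← hhL, Polynomial.map_map, mapRingHom_comp]
    rfl
  have hfLN : Irreducible (fL.map (mapRingHom (algebraMap L N))) := by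
    refine (hfLm.map _).irreducible_of_irreducible_map (mapRingHom (algebraMap N Qbar)) _ ?_
    rw [Polynomial.map_map, mapRingHom_comp, ← IsScalarTower.algebraMap_eq, hfL']
    exact hfirr
  have hhLi : Irreducible hL := hhLm.irreducible_of_irreducible_map (mapRingHom ρ) _ (hhL ▸ hhirr)
  obtain ⟨t, ht, x, hxint, hx, hxN, hx1, hxu⟩ :=
    exists_good_specialization (Ω := Qbar) hfLm hfLN hhLm hhLi n₀
  have hspec : ∀ p : L[X][X], (p.map (evalRingHom (t : L))).map (algebraMap L Qbar) =
      (p.map (mapRingHom (algebraMap L Qbar))).map (evalRingHom (t : Qbar)) := by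
    intro p
    rw [Polynomial.map_map, Polynomial.map_map]
    congr 1
    ext <;> simp
  rw [hspec, hfL'] at hx
  simp only [hspec, hhL'] at hxu
  let ht' := h'.map (evalRingHom (t : Qbar))
  have hhm : ht'.Monic := (hh.map _).map _
  let D : Finset Qbar := C ∪ {x} ∪ ht'.roots.toFinset
  let N' : IntermediateField ℚ Qbar := adjoin ℚ (D : Set Qbar)
  have := finiteDimensional_adjoin_finset D
  have hDN : ∀ a ∈ D, a ∈ N' := fun a ha => subset_adjoin ℚ _ ha
  obtain ⟨T, hT⟩ := exists_finset_agree N'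
  have hLx : ∀ a : Qbar, a ∈ L → a ∈ L⟮x⟯ := fun a ha => L⟮x⟯.algebraMap_mem ⟨a, ha⟩
  have hfd : f.natDegree = fL.natDegree := by rw [← hfL, hfLm.natDegree_map]
  refine ⟨L⟮x⟯.toSubfield, T, fun a ha => ?_, fun hd hle => ?_, t, ht, fun F hF => ⟨?_, ?_⟩⟩
  · have haN : a ∈ N := hCN a (Finset.mem_union_left _ ha)
    refine ⟨fun h => ?_, fun h => hLx a ⟨h, haN⟩⟩
    obtain ⟨y, hy⟩ := hxN ⟨a, haN⟩ h
    have : (y : Qbar) = a := congrArg Subtype.val hy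
    exact this ▸ y.2.1
  · refine hx1 (hfd ▸ hd) ⟨⟨x, ?_⟩, rfl⟩
    exact adjoin.mono ℚ _ _ (by simp [C]) (hle (mem_adjoin_simple_self L x))
  · exact fun a ha => hT F _ hF a (hDN a (by simp [D, C, ha]))
  · have hx' : x ∈ F := (hT F _ hF x (hDN x (by simp [D]))).2 (mem_adjoin_simple_self L x)
    refine ⟨⟨x, hx', hx⟩, fun u hu hud hudvd => ?_⟩
    have hlift : u.map F.subtype ∈ lifts (algebraMap N' Qbar) := by
      refine (IsAlgClosed.splits _).mem_lift_of_roots_mem_range (hu.map _) _ fun a ha => ?_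
      have : a ∈ ht'.roots := (mem_roots hhm.ne_zero).2
        (eval_eq_zero_of_dvd_of_eval_eq_zero hudvd (mem_roots'.1 ha).2)
      exact ⟨⟨a, hDN a (by simpa [D] using Or.inr (Or.inr (by simpa using this)))⟩, rfl⟩
    have hlift' : u.map F.subtype ∈ lifts (algebraMap L⟮x⟯ Qbar) := by
      rw [lifts_iff_coeff_lifts] at hlift ⊢
      intro n
      obtain ⟨y, hy⟩ := hlift n
      have h1 : (u.map F.subtype).coeff n ∈ N' := hy ▸ y.2
      have h2 : (u.map F.subtype).coeff n ∈ F := by rw [coeff_map]; exact (u.coeff n).2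
      exact ⟨⟨_, (hT F _ hF _ h1).1 h2⟩, rfl⟩
    obtain ⟨v, hv, hvd, hvm⟩ := lifts_and_natDegree_eq_and_monic hlift' (hu.map _)
    have := hxu v (by rwa [hvd, hu.natDegree_map]) (by rwa [hv])
    rwa [hvd, hu.natDegree_map, ← hhLm.natDegree_map (mapRingHom (algebraMap L Qbar)), hhL',
      ← hfLm.natDegree_map (mapRingHom (algebraMap L Qbar)), hfL'] at this

theorem isNowhereDense_badSet (f h : Qbar[X][X]) (n₀ : ℕ) : IsNowhereDense (badSet f h n₀) := by
  refine isNowhereDense_of_forall_mem fun F₀ hF₀ U hU hFU => ?_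
  obtain ⟨⟨g, k, rfl, rfl, hg, hk, hki⟩, hgi, -⟩ := hF₀
  obtain ⟨S, hS⟩ := exists_agree_subset hU hFU
  obtain ⟨F₁, T, hF₁, -, t, ht, hF⟩ := exists_agree_isGoodSpecialization hg hgi hk hki S n₀
  refine ⟨_, fun F hFT => hS fun a ha => ?_, isOpen_agree T F₁, ⟨F₁, fun _ _ => Iff.rfl⟩, ?_⟩
  · exact ((hF F hFT).1 a ha).trans (hF₁ a ha)
  · exact Set.disjoint_left.2 fun F hFT hb => hb.2.2 t ht (hF F hFT).2

theorem irreducible_X_sq_sub_C_X {k : Type*} [Field k] : Irreducible (X ^ 2 - C X : k[X][X]) := by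
  have hm : (X ^ 2 - C X : k[X][X]).Monic := monic_X_pow_sub_C X two_ne_zero
  have hd : (X ^ 2 - C X : k[X][X]).natDegree = 2 := natDegree_X_pow_sub_C
  rw [hm.irreducible_iff_roots_eq_zero_of_degree_le_three hd.ge (by omega)]
  refine Multiset.eq_zero_of_forall_notMem fun p hp => ?_
  have h := (mem_roots'.1 hp).2
  rw [IsRoot, eval_sub, eval_pow, eval_X, eval_C, sub_eq_zero] at h
  have := congrArg natDegree h
  rw [natDegree_pow, natDegree_X] at this
  omega

theorem isNowhereDense_le (N : IntermediateField ℚ Qbar) [FiniteDimensional ℚ N] :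
    IsNowhereDense {F : Subfield Qbar | F ≤ N.toSubfield} := by
  classical
  refine isNowhereDense_of_forall_mem fun F₀ hF₀ U hU hFU => ?_
  obtain ⟨S, hS⟩ := exists_agree_subset hU hFU
  obtain ⟨p, hp⟩ := (essFiniteType_iff (K := N)).1 inferInstance
  have hg : (X ^ 2 - C X : F₀[X][X]).Monic := monic_X_pow_sub_C X two_ne_zero
  obtain ⟨F₁, T, hF₁, hN, t, ht, hF⟩ := exists_agree_isGoodSpecialization hg
    (by simpa using irreducible_X_sq_sub_C_X) monic_X irreducible_X (S ∪ p) 0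
  have hN' : ¬ F₁ ≤ N.toSubfield := fun hle => hN (by simp) (hle.trans (by
    rw [← hp]
    exact adjoin.mono ℚ _ _ (by simp)))
  obtain ⟨y, hy, hyN⟩ := SetLike.not_le_iff_exists.1 hN'
  refine ⟨_, fun F hFT => hS fun a ha => ?_, isOpen_agree (insert y T) F₁,
    ⟨F₁, fun _ _ => Iff.rfl⟩, ?_⟩
  · have h' := hF F fun b hb => hFT b (Finset.mem_insert_of_mem hb)
    exact (h'.1 a (Finset.mem_union_left _ ha)).trans (hF₁ a (Finset.mem_union_left _ ha))
  · exact Set.disjoint_left.2 fun F hFT hb =>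
      hyN (hb ((hFT y (Finset.mem_insert_self _ _)).2 hy))

theorem countable_polynomial {R : Type*} [CommRing R] [Countable R] : Countable R[X] := by
  rw [← Cardinal.mk_le_aleph0_iff]
  exact cardinalMk_le_max.trans (max_le (Cardinal.mk_le_aleph0_iff.2 inferInstance) le_rfl)

instance countable_qbar : Countable Qbar := by
  rw [← Cardinal.mk_le_aleph0_iff]
  exact (Algebra.IsAlgebraic.cardinalMk_le_max ℚ Qbar).trans
    (max_le (Cardinal.mk_le_aleph0_iff.2 inferInstance) le_rfl)

theorem exists_ringEquiv_extend {F F' : Subfield Qbar} (e : F ≃+* F') :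
    ∃ σ : Qbar ≃+* Qbar, ∀ x : F, σ x = e x := by
  have : Algebra.IsAlgebraic F Qbar := Algebra.IsAlgebraic.tower_top (K := ℚ) F
  have : Algebra.IsAlgebraic F' Qbar := Algebra.IsAlgebraic.tower_top (K := ℚ) F'
  have : IsAlgClosure F Qbar := ⟨inferInstance, inferInstance⟩
  have : IsAlgClosure F' Qbar := ⟨inferInstance, inferInstance⟩
  exact ⟨IsAlgClosure.equivOfEquiv Qbar Qbar e, IsAlgClosure.equivOfEquiv_algebraMap Qbar Qbar e⟩

theorem finite_range_map_ringEquiv (f : Qbar[X][X]) :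
    (Set.range fun σ : Qbar ≃+* Qbar => f.map (mapRingHom (σ : Qbar →+* Qbar))).Finite := by
  classical
  let C : Finset Qbar := f.coeffs.biUnion fun c => c.coeffs
  let N : IntermediateField ℚ Qbar := adjoin ℚ (C : Set Qbar)
  have := finiteDimensional_adjoin_finset C
  have hf : f ∈ lifts (mapRingHom (algebraMap N Qbar)) := by
    rw [lifts_iff_coeff_lifts]
    intro i
    obtain ⟨q, hq⟩ := (mem_lifts _).1
      ((lifts_iff_coeff_lifts (f := algebraMap N Qbar) (f.coeff i)).2 fun j => by
        by_cases h0 : (f.coeff i).coeff j = 0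
        · exact ⟨0, by rw [h0, map_zero]⟩
        · have hi : f.coeff i ≠ 0 := fun h => h0 (by rw [h, coeff_zero])
          exact ⟨⟨_, subset_adjoin ℚ _ (Finset.mem_biUnion.2
            ⟨_, coeff_mem_coeffs hi, coeff_mem_coeffs h0⟩)⟩, rfl⟩)
    exact ⟨q, hq⟩
  obtain ⟨g, hg⟩ := (mem_lifts _).1 hf
  refine (Set.finite_range fun ρ : N →ₐ[ℚ] Qbar => g.map (mapRingHom (ρ : N →+* Qbar))).subset ?_
  rintro _ ⟨σ, rfl⟩
  refine ⟨((σ : Qbar →+* Qbar).comp (algebraMap N Qbar)).toRatAlgHom, ?_⟩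
  simp only [← hg, Polynomial.map_map, mapRingHom_comp]
  rfl

theorem IsGoodSpecialization.map_ringEquiv {F F' : Subfield Qbar} {f h : Qbar[X][X]} {t : ℕ}
    (σ : Qbar ≃+* Qbar) (e : F ≃+* F') (he : ∀ x : F, σ x = e x)
    (hg : IsGoodSpecialization F f h t) :
    IsGoodSpecialization F' (f.map (mapRingHom (σ : Qbar →+* Qbar)))
      (h.map (mapRingHom (σ : Qbar →+* Qbar))) t := by
  have hs : ∀ p : Qbar[X][X],
      (p.map (mapRingHom (σ : Qbar →+* Qbar))).map (evalRingHom (t : Qbar)) =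
        (p.map (evalRingHom (t : Qbar))).map (σ : Qbar →+* Qbar) := by
    intro p
    rw [Polynomial.map_map, Polynomial.map_map]
    congr 1
    ext <;> simp
  have hinj : Function.Injective (mapRingHom (σ : Qbar →+* Qbar)) := map_injective _ σ.injective
  obtain ⟨⟨x, hx, hx0⟩, hu⟩ := hg
  refine ⟨⟨σ x, ?_, ?_⟩, fun u hum hud hdvd => ?_⟩
  · rw [he ⟨x, hx⟩]
    exact (e ⟨x, hx⟩).2
  · rw [hs, ← RingEquiv.coe_toRingHom, eval_map_hom, hx0, map_zero]
  · rw [natDegree_map_eq_of_injective hinj, natDegree_map_eq_of_injective hinj]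
    have h1 := hu (u.map (e.symm : F' →+* F)) (hum.map _) (by rwa [hum.natDegree_map]) (by
      rw [← map_dvd_map (σ : Qbar →+* Qbar) σ.injective ((hum.map _).map _), ← hs]
      convert hdvd using 1
      rw [Polynomial.map_map, Polynomial.map_map]
      congr 1
      ext y
      simp [he])
    rwa [hum.natDegree_map] at h1

theorem mem_badSet_map_ringEquiv {F F' : Subfield Qbar} {f h : Qbar[X][X]} {n₀ : ℕ}
    (σ : Qbar ≃+* Qbar) (e : F ≃+* F') (he : ∀ x : F, σ x = e x) (hF : F ∈ badSet f h n₀) :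
    F' ∈ badSet (f.map (mapRingHom (σ : Qbar →+* Qbar)))
      (h.map (mapRingHom (σ : Qbar →+* Qbar))) n₀ := by
  obtain ⟨⟨g, k, rfl, rfl, hg, hk, hki⟩, hfi, ht⟩ := hF
  have hc : ((σ : Qbar →+* Qbar)).comp F.subtype = F'.subtype.comp (e : F →+* F') := by
    ext x; exact he x
  refine ⟨⟨g.map (mapRingHom (e : F →+* F')), k.map (mapRingHom (e : F →+* F')), ?_, ?_,
    hg.map _, hk.map _, ?_⟩, ?_, fun t ht0 hgood => ht t ht0 ?_⟩
  · rw [Polynomial.map_map, Polynomial.map_map, mapRingHom_comp, mapRingHom_comp, hc]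
  · rw [Polynomial.map_map, Polynomial.map_map, mapRingHom_comp, mapRingHom_comp, hc]
  · exact (MulEquiv.irreducible_iff (mapEquiv (mapEquiv e))).2 hki
  · exact (MulEquiv.irreducible_iff (mapEquiv (mapEquiv σ))).2 hfi
  · have := hgood.map_ringEquiv σ.symm e.symm fun x => by
      rw [RingEquiv.symm_apply_eq, he, RingEquiv.apply_symm_apply]
    have h1 : ((σ.symm : Qbar ≃+* Qbar) : Qbar →+* Qbar).comp (σ : Qbar →+* Qbar) = RingHom.id _ := by
      ext x; simp
    simpa only [Polynomial.map_map, mapRingHom_comp, ← RingHom.comp_assoc, h1, RingHom.id_comp] using this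

theorem isOpenMap_quotientMk : IsOpenMap (Quotient.mk isoSetoid) := by
  classical
  intro U hU
  refine isOpen_coinduced.2 (isOpen_iff_forall_mem_open.2 ?_)
  rintro F ⟨G, hG, hGF⟩
  obtain ⟨e⟩ : Nonempty (G ≃+* F) := Quotient.exact hGF
  obtain ⟨σ, hσ⟩ := exists_ringEquiv_extend e
  obtain ⟨S, hS⟩ := exists_agree_subset hU hG
  refine ⟨_, ?_, isOpen_agree (S.image σ) F, fun _ _ => Iff.rfl⟩
  intro F' hF'
  have hσF : ∀ a, σ a ∈ F ↔ a ∈ G := by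
    refine fun a => ⟨fun h => ?_, fun h => ?_⟩
    · have := hσ (e.symm ⟨σ a, h⟩)
      rw [RingEquiv.apply_symm_apply] at this
      rw [← σ.injective this]
      exact (e.symm ⟨σ a, h⟩).2
    · rw [hσ ⟨a, h⟩]
      exact (e ⟨a, h⟩).2
  refine ⟨F'.comap (σ : Qbar →+* Qbar), hS fun a ha => ?_, Quotient.sound ⟨?_⟩⟩
  · exact (hF' (σ a) (Finset.mem_image_of_mem _ ha)).trans (hσF a)
  · refine RingEquiv.ofBijective (((σ : Qbar →+* Qbar).comp
      (F'.comap (σ : Qbar →+* Qbar)).subtype).codRestrict F' fun x => x.2) ⟨?_, fun y => ?_⟩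
    · exact RingHom.injective _
    · exact ⟨⟨σ.symm y, by simp⟩, Subtype.ext (σ.apply_symm_apply y)⟩

theorem IsNowhereDense.image_quotientMk {B : Set (Subfield Qbar)} (hB : IsNowhereDense B)
    (hsat : ∀ F ∈ B, ∀ F' : Subfield Qbar, Nonempty (F ≃+* F') → F' ∈ B) :
    IsNowhereDense (Quotient.mk isoSetoid '' B) := by
  have hc : Continuous (Quotient.mk isoSetoid) := continuous_quotient_mk'
  have h : Quotient.mk isoSetoid ⁻¹' (Quotient.mk isoSetoid '' B) = B := by
    refine Set.Subset.antisymm ?_ (Set.subset_preimage_image _ _)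
    rintro F ⟨G, hG, hGF⟩
    exact hsat G hG F (Quotient.exact hGF)
  have h2 : Quotient.mk isoSetoid ⁻¹' interior (closure (Quotient.mk isoSetoid '' B)) = ∅ := by
    rw [isOpenMap_quotientMk.preimage_interior_eq_interior_preimage hc,
      isOpenMap_quotientMk.preimage_closure_eq_closure_preimage hc, h]
    exact hB
  rw [IsNowhereDense, Set.eq_empty_iff_forall_notMem]
  intro q hq
  obtain ⟨F, rfl⟩ := Quotient.exists_rep q
  exact Set.eq_empty_iff_forall_notMem.1 h2 F hq

theorem isNowhereDense_image_badSet (f h : Qbar[X][X]) (n₀ : ℕ) :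
    IsNowhereDense (Quotient.mk isoSetoid '' badSet f h n₀) := by
  let A : Set (Qbar[X][X] × Qbar[X][X]) := Set.range fun σ : Qbar ≃+* Qbar =>
    (f.map (mapRingHom (σ : Qbar →+* Qbar)), h.map (mapRingHom (σ : Qbar →+* Qbar)))
  have hA : A.Finite := by
    refine ((finite_range_map_ringEquiv f).prod (finite_range_map_ringEquiv h)).subset ?_
    rintro _ ⟨σ, rfl⟩
    exact ⟨⟨σ, rfl⟩, ⟨σ, rfl⟩⟩
  have hmem : ∀ p ∈ A, ∀ F ∈ badSet p.1 p.2 n₀, ∀ F' : Subfield Qbar, Nonempty (F ≃+* F') →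
      F' ∈ ⋃ p ∈ A, badSet p.1 p.2 n₀ := by
    rintro _ ⟨σ, rfl⟩ F hF F' ⟨e⟩
    obtain ⟨τ, hτ⟩ := exists_ringEquiv_extend e
    refine Set.mem_iUnion₂.2 ⟨_, ⟨σ.trans τ, rfl⟩, ?_⟩
    have := mem_badSet_map_ringEquiv τ e hτ hF
    rwa [Polynomial.map_map, Polynomial.map_map, mapRingHom_comp] at this
  have hB : IsNowhereDense (⋃ p ∈ A, badSet p.1 p.2 n₀) :=
    IsNowhereDense.biUnion_finite hA fun _ _ => isNowhereDense_badSet _ _ _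
  refine (hB.image_quotientMk fun F hF F' he => ?_).mono (Set.image_mono fun F hF => ?_)
  · obtain ⟨p, hp, hF⟩ := Set.mem_iUnion₂.1 hF
    exact hmem p hp F hF F' he
  · refine Set.mem_iUnion₂.2 ⟨(f, h), ⟨RingEquiv.refl _, ?_⟩, hF⟩
    simp

theorem isNowhereDense_singleton_mk (K : Subfield Qbar) (hK : FiniteDimensional ℚ K) :
    IsNowhereDense {Quotient.mk isoSetoid K} := by
  have hB : IsNowhereDense (⋃ ρ ∈ (Set.univ : Set (K →ₐ[ℚ] Qbar)),
      {F : Subfield Qbar | F ≤ ρ.fieldRange.toSubfield}) :=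
    IsNowhereDense.biUnion_finite Set.finite_univ fun ρ _ =>
      have : FiniteDimensional ℚ ρ.fieldRange := ρ.toLinearMap.finiteDimensional_range
      isNowhereDense_le ρ.fieldRange
  have hB' : IsNowhereDense {F : Subfield Qbar | Nonempty (F ≃+* K)} := by
    refine hB.mono ?_
    rintro F ⟨e⟩
    refine Set.mem_iUnion₂.2 ⟨(F.subtype.comp (e.symm : K →+* F)).toRatAlgHom, trivial, ?_⟩
    intro x hx
    exact ⟨e ⟨x, hx⟩, by simp⟩
  refine (hB'.image_quotientMk fun F ⟨e⟩ F' ⟨e'⟩ => ⟨e'.symm.trans e⟩).mono ?_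
  rintro _ rfl
  exact ⟨K, ⟨RingEquiv.refl _⟩, rfl⟩

theorem isMeagre_image_of_subset {A : Set (Subfield Qbar)} (K : Subfield Qbar)
    (hK : FiniteDimensional ℚ K) (h : ∀ F ∈ A, F = K ∨ ∃ f h n₀, F ∈ badSet f h n₀) :
    IsMeagre (Quotient.mk isoSetoid '' A) := by
  have := countable_polynomial (R := Qbar)
  have := countable_polynomial (R := Qbar[X])
  refine isMeagre_iff_countable_union_isNowhereDense.2 ⟨insert {Quotient.mk isoSetoid K}
    (Set.range fun p : (Qbar[X][X] × Qbar[X][X]) × ℕ =>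
      Quotient.mk isoSetoid '' badSet p.1.1 p.1.2 p.2), ?_, ?_, ?_⟩
  · rintro _ (rfl | ⟨p, rfl⟩)
    · exact isNowhereDense_singleton_mk K hK
    · exact isNowhereDense_image_badSet _ _ _
  · exact (Set.countable_range _).insert _
  · rintro _ ⟨F, hF, rfl⟩
    rcases h F hF with rfl | ⟨f, h, n₀, hb⟩
    · exact ⟨_, Set.mem_insert _ _, rfl⟩
    · exact ⟨_, Set.mem_insert_of_mem _ ⟨((f, h), n₀), rfl⟩, F, hb, rfl⟩

end

section
open Polynomial

/-- A ring homomorphism of fields whose image is algebraically closed in the codomain. -/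
def IsRelAlgClosed {E M : Type*} [Field E] [Field M] (ι : E →+* M) : Prop :=
  ∀ x (p : E[X]), p ≠ 0 → eval₂ ι x p = 0 → x ∈ ι.range

attribute [local instance] Polynomial.algebra in
theorem isIntegral_coeff_coeff_of_mul_eq {E L : Type*} [Field E] [Field L] [Algebra E L]
    {f : E[X][X]} {u v : L[X][X]} (hf : f.Monic) (hu : u.Monic)
    (h : u * v = f.map (mapRingHom (algebraMap E L))) (i j : ℕ) :
    IsIntegral E ((u.coeff i).coeff j) := by
  have h1 : u.map (algebraMap L[X] (FractionRing L[X])) ∣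
      f.map (algebraMap E[X] (FractionRing L[X])) := by
    refine ⟨v.map (algebraMap L[X] (FractionRing L[X])), ?_⟩
    rw [← Polynomial.map_mul, h, map_map]
    rfl
  obtain ⟨q, hq⟩ := (mem_lifts _).1
    (integralClosure.mem_lifts_of_monic_of_dvd_map (FractionRing L[X]) hf (hu.map _) h1)
  have h2 : IsIntegral E[X] (algebraMap L[X] (FractionRing L[X]) (u.coeff i)) := by
    rw [← coeff_map, ← hq, coeff_map]
    exact (q.coeff i).2
  have h3 : IsIntegral E[X] (u.coeff i) :=
    (isIntegral_algebraMap_iff (IsFractionRing.injective L[X] (FractionRing L[X]))).1 h2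
  exact h3.coeff j

theorem exists_polynomial_coeff {A : Type*} [CommRing A] (c : ℕ → ℕ → A) (D M : ℕ)
    (hc : ∀ i j, D < i ∨ M < j → c i j = 0) :
    ∃ P : A[X][X], ∀ i j, (P.coeff i).coeff j = c i j := by
  refine ⟨∑ i ∈ Finset.range (D + 1), monomial i (∑ j ∈ Finset.range (M + 1), monomial j (c i j)),
    fun i j => ?_⟩
  simp only [finsetSum_coeff, coeff_monomial, apply_ite (fun p : A[X] => p.coeff j), coeff_zero,
    Finset.sum_ite_eq', Finset.mem_range]
  split_ifs with h h'
  · rfl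
  · exact (hc i j (Or.inr (by lia))).symm
  · exact (hc i j (Or.inl (by lia))).symm

theorem eval_map_eval₂RingHom {A B : Type*} [CommRing A] [CommRing B] (ι : A →+* B) (a y : B)
    (P : A[X][X]) {D M : ℕ} (hP : ∀ i j, D < i ∨ M < j → (P.coeff i).coeff j = 0) :
    eval y (P.map (eval₂RingHom ι a)) =
      ∑ i ∈ Finset.range (D + 1), ∑ j ∈ Finset.range (M + 1),
        ι ((P.coeff i).coeff j) * (a ^ j * y ^ i) := by
  have hD : (P.map (eval₂RingHom ι a)).natDegree < D + 1 := by
    refine Nat.lt_succ_of_le (natDegree_le_iff_coeff_eq_zero.2 fun i hi => ?_)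
    rw [coeff_map, show P.coeff i = 0 from ext fun j => hP i j (Or.inl hi), map_zero]
  rw [eval_eq_sum_range' hD]
  refine Finset.sum_congr rfl fun i _ => ?_
  have hM : (P.coeff i).natDegree < M + 1 :=
    Nat.lt_succ_of_le (natDegree_le_iff_coeff_eq_zero.2 fun j hj => hP i j (Or.inr hj))
  rw [coeff_map, coe_eval₂RingHom, eval₂_eq_sum_range' _ hM, Finset.sum_mul]
  exact Finset.sum_congr rfl fun j _ => mul_assoc _ _ _

theorem exists_coeff_bound {A : Type*} [CommRing A] (P : A[X][X]) :
    ∃ M, ∀ i j, P.natDegree < i ∨ M < j → (P.coeff i).coeff j = 0 := by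
  refine ⟨P.support.sup fun i => (P.coeff i).natDegree, fun i j h => ?_⟩
  rcases h with h | h
  · rw [coeff_eq_zero_of_natDegree_lt h, coeff_zero]
  · by_cases hi : i ∈ P.support
    · exact coeff_eq_zero_of_natDegree_lt
        ((Finset.le_sup (f := fun i => (P.coeff i).natDegree) hi).trans_lt h)
    · rw [notMem_support_iff.1 hi, coeff_zero]

theorem IsRelAlgClosed.normalizedTrace_mem_range {E F L : Type*} [Field E] [Field F] [Field L]
    [CharZero F] [Algebra F L] [Algebra.IsIntegral F L] {ι : E →+* F} (hι : IsRelAlgClosed ι) {c : L}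
    (hc : ((algebraMap F L).comp ι).IsIntegralElem c) :
    Algebra.normalizedTrace F L c ∈ ι.fieldRange := by
  obtain ⟨p, hp, hpc⟩ := hc
  let _ : Algebra E F := ι.toAlgebra
  have hdvd : minpoly F c ∣ p.map (algebraMap E F) := by
    refine minpoly.dvd F c ?_
    rw [aeval_def, eval₂_map]
    exact hpc
  obtain ⟨q, hq⟩ := (mem_lifts _).1 (integralClosure.mem_lifts_of_monic_of_dvd_map F hp
    (minpoly.monic (Algebra.IsIntegral.isIntegral c)) hdvd)
  have hcoeff : ∀ i, (minpoly F c).coeff i ∈ ι.fieldRange := fun i => by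
    have : IsIntegral E ((minpoly F c).coeff i) := by
      rw [← hq, coeff_map]
      exact (q.coeff i).2
    obtain ⟨r, hr, hr0⟩ := this
    exact hι _ r hr.ne_zero hr0
  rw [Algebra.normalizedTrace_minpoly, smul_eq_mul]
  refine mul_mem (inv_mem (natCast_mem _ _)) (neg_mem ?_)
  unfold nextCoeff
  split_ifs
  · exact zero_mem _
  · exact hcoeff _

theorem irreducible_map_of_minimal {E F : Type*} [Field E] [Field F] [CharZero F]
    {ι : E →+* F} (hι : IsRelAlgClosed ι) {f : E[X][X]} (hf : f.Monic) (hdeg : 0 < f.natDegree)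
    {a α : F} (hroot : eval α (f.map (eval₂RingHom ι a)) = 0)
    (hmin : ∀ P : E[X][X], P.Monic → eval α (P.map (eval₂RingHom ι a)) = 0 →
      f.natDegree ≤ P.natDegree) {L : Type*} [Field L] (ψ : E →+* L) :
    Irreducible (f.map (mapRingHom ψ)) := by
  let _ : Algebra E L := ψ.toAlgebra
  let B := integralClosure E L
  obtain ⟨φ, hφ⟩ := exists_ringHom_extend (B := B) ((algebraMap F (AlgebraicClosure F)).comp ι)
  have key : ∀ u v : B[X][X], u.Monic → v.Monic →
      u * v = f.map (mapRingHom (algebraMap E B)) →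
      eval (algebraMap F (AlgebraicClosure F) α)
        (u.map (eval₂RingHom φ (algebraMap F (AlgebraicClosure F) a))) = 0 → v = 1 := by
    intro u v hu hv huv h0
    obtain ⟨M, hM⟩ := exists_coeff_bound u
    have hInt : ∀ i j, Algebra.normalizedTrace F (AlgebraicClosure F) (φ ((u.coeff i).coeff j)) ∈
        ι.fieldRange := fun i j => by
      refine hι.normalizedTrace_mem_range ?_
      obtain ⟨p, hp, hpc⟩ := Algebra.IsIntegral.isIntegral (R := E) ((u.coeff i).coeff j)
      refine ⟨p, hp, ?_⟩
      rw [← hφ, ← hom_eval₂, hpc, map_zero]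
    choose e he using hInt
    have he0 : ∀ i j, u.natDegree < i ∨ M < j → e i j = 0 := fun i j h => by
      apply ι.injective
      rw [he, hM i j h, map_zero, map_zero, map_zero]
    obtain ⟨P, hP⟩ := exists_polynomial_coeff e _ M he0
    have hPdeg : P.natDegree ≤ u.natDegree :=
      natDegree_le_iff_coeff_eq_zero.2 fun i hi => ext fun j => by
        rw [hP, he0 i j (Or.inl hi), coeff_zero]
    have hP1 : P.Monic := by
      refine monic_of_natDegree_le_of_coeff_eq_one _ hPdeg (ext fun j => ι.injective ?_)
      rw [hP, he, hu.coeff_natDegree, coeff_one, coeff_one]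
      split_ifs
      · rw [map_one φ, map_one ι, ← map_one (algebraMap F (AlgebraicClosure F)),
          Algebra.normalizedTrace_algebraMap_apply_eq_self]
      · rw [map_zero, map_zero, map_zero]
    have hPe : eval α (P.map (eval₂RingHom ι a)) = 0 := by
      rw [eval_map_eval₂RingHom ι a α P (D := u.natDegree) (M := M)
        (fun i j h => by rw [hP, he0 i j h])]
      rw [eval_map_eval₂RingHom φ _ _ u hM] at h0
      have := congrArg (Algebra.normalizedTrace F (AlgebraicClosure F)) h0
      rw [map_zero, map_sum] at this
      rw [← this]
      refine Finset.sum_congr rfl fun i _ => ?_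
      rw [map_sum]
      refine Finset.sum_congr rfl fun j _ => ?_
      rw [hP, he, ← map_pow, ← map_pow, ← map_mul, mul_comm, mul_comm (φ _), ← Algebra.smul_def,
        map_smul, smul_eq_mul]
    have h1 := hmin P hP1 hPe
    have h2 := congrArg natDegree huv
    rw [hu.natDegree_mul hv, hf.natDegree_map] at h2
    exact hv.natDegree_eq_zero.1 (by lia)
  rw [(hf.map _).irreducible_iff_natDegree']
  have hmap := hf.map (mapRingHom ψ)
  refine ⟨fun h => ?_, fun u v hu hv huv => ?_⟩
  · have := hf.natDegree_map (mapRingHom ψ)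
    rw [h, natDegree_one] at this
    lia
  intro hmem
  have hmem0 := (Finset.mem_Ioc.1 hmem).1
  obtain ⟨u, hu', rfl⟩ := hu.exists_monic_lift (algebraMap B L) fun i j =>
    ⟨⟨_, isIntegral_coeff_coeff_of_mul_eq hf hu huv i j⟩, rfl⟩
  have huv' := huv
  rw [mul_comm] at huv'
  obtain ⟨v, hv', rfl⟩ := hv.exists_monic_lift (algebraMap B L) fun i j =>
    ⟨⟨_, isIntegral_coeff_coeff_of_mul_eq hf hv huv' i j⟩, rfl⟩
  have hprod : u * v = f.map (mapRingHom (algebraMap E B)) := by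
    apply map_injective (mapRingHom (algebraMap B L))
      (map_injective _ (FaithfulSMul.algebraMap_injective B L))
    rw [Polynomial.map_mul, huv, map_map, mapRingHom_comp]
    rfl
  have h0 : eval (algebraMap F (AlgebraicClosure F) α)
      ((u * v).map (eval₂RingHom φ (algebraMap F (AlgebraicClosure F) a))) = 0 := by
    have : (eval₂RingHom φ (algebraMap F (AlgebraicClosure F) a)).comp
        (mapRingHom (algebraMap E B)) = (algebraMap F (AlgebraicClosure F)).comp
          (eval₂RingHom ι a) := by
      refine ringHom_ext (fun x => ?_) ?_
      · have := congrArg (fun g : E →+* AlgebraicClosure F => g x) hφ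
        simpa using this
      · simp
    rw [hprod, map_map, this, ← map_map, eval_map_hom, hroot, map_zero]
  have hd : ∀ w : B[X][X], w.Monic → (w.map (mapRingHom (algebraMap B L))).natDegree = w.natDegree :=
    fun w hw => hw.natDegree_map _
  rw [Polynomial.map_mul, eval_mul] at h0
  rcases mul_eq_zero.1 h0 with h0 | h0
  · have := key u v hu' hv' hprod h0
    rw [hd v hv', this, natDegree_one] at hmem0
    lia
  · have := key v u hv' hu' (by rw [mul_comm v u, hprod]) h0
    rw [this, Polynomial.map_one, one_mul] at huv
    rw [huv, hf.natDegree_map] at hmem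
    have := (Finset.mem_Ioc.1 hmem).2
    lia

theorem irreducible_map_of_isRelAlgClosed {E M : Type*} [Field E] [Field M] {ι : E →+* M}
    (hι : IsRelAlgClosed ι) {h : E[X][X]} (hh : h.Monic) (hirr : Irreducible h) :
    Irreducible (h.map (mapRingHom ι)) := by
  let _ : Algebra E M := ι.toAlgebra
  rw [(hh.map _).irreducible_iff_natDegree']
  refine ⟨fun h1 => ?_, fun u v hu hv huv hmem => ?_⟩
  · have := hh.natDegree_map (mapRingHom ι)
    rw [h1, natDegree_one] at this
    exact hirr.1 (by rw [hh.natDegree_eq_zero.1 this.symm]; exact isUnit_one)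
  have hmem0 := (Finset.mem_Ioc.1 hmem).1
  have hmem1 := (Finset.mem_Ioc.1 hmem).2
  have key : ∀ w z : M[X][X], w.Monic → w * z = h.map (mapRingHom ι) → ∀ i j,
      (w.coeff i).coeff j ∈ ι.range := fun w z hw hwz i j => by
    obtain ⟨p, hp, hp0⟩ := isIntegral_coeff_coeff_of_mul_eq (E := E) hh hw hwz i j
    exact hι _ p hp.ne_zero hp0
  obtain ⟨u, hu', rfl⟩ := hu.exists_monic_lift ι (key u v hu huv)
  obtain ⟨v, hv', rfl⟩ := hv.exists_monic_lift ι (key v _ hv ((mul_comm _ _).trans huv))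
  rw [← Polynomial.map_mul] at huv
  have huv := map_injective _ (map_injective _ ι.injective) huv
  rw [hv'.natDegree_map] at hmem0 hmem1
  rw [hh.natDegree_map] at hmem1
  rcases hirr.isUnit_or_isUnit huv.symm with hu1 | hv1
  · rw [hu'.eq_one_of_isUnit hu1, one_mul] at huv
    rw [huv] at hmem0 hmem1
    lia
  · rw [hv'.eq_one_of_isUnit hv1, natDegree_one] at hmem0
    lia

theorem isRelAlgClosed_algebraicClosure (k F : Type*) [Field k] [Field F] [Algebra k F] :
    IsRelAlgClosed (algebraMap (algebraicClosure k F) F) := fun x p hp hx => by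
  have h1 : x ∈ algebraicClosure (algebraicClosure k F) F :=
    mem_algebraicClosure_iff.2 ⟨p, hp, hx⟩
  rw [algebraicClosure.algebraicClosure_eq_bot] at h1
  exact h1

theorem IsRelAlgClosed.comp_equiv {E E' M : Type*} [Field E] [Field E'] [Field M] {ι : E →+* M}
    (hι : IsRelAlgClosed ι) (e : E' ≃+* E) : IsRelAlgClosed (ι.comp (e : E' →+* E)) :=
  fun x p hp hx => by
    obtain ⟨y, rfl⟩ := hι x (p.map (e : E' →+* E))
      ((Polynomial.map_ne_zero_iff e.injective).2 hp) (by rw [eval₂_map]; exact hx)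
    exact ⟨e.symm y, by simp⟩

theorem exists_aeval_algebraicClosure_iff {k F : Type*} [Field k] [Field F] [Algebra k F] (p : k[X]) :
    (∃ x : algebraicClosure k F, aeval x p = 0) ↔ ∃ x : F, aeval x p = 0 := by
  constructor
  · rintro ⟨x, hx⟩
    exact ⟨x, by rw [← IntermediateField.algebraMap_apply, aeval_algebraMap_apply, hx, map_zero]⟩
  · rintro ⟨x, hx⟩
    by_cases hp : p = 0
    · exact ⟨0, by simp [hp]⟩
    · refine ⟨⟨x, mem_algebraicClosure_iff.2 ⟨p, hp, hx⟩⟩, ?_⟩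
      apply (algebraMap (algebraicClosure k F) F).injective
      rw [← aeval_algebraMap_apply, map_zero]
      exact hx

theorem countable_of_isAlgebraic (k F : Type*) [Field k] [Field F] [Algebra k F] [Countable k]
    [Algebra.IsAlgebraic k F] : Countable F := by
  have h := Algebra.IsAlgebraic.lift_cardinalMk_le_max k F
  rw [← Cardinal.mk_le_aleph0_iff, ← Cardinal.lift_le_aleph0]
  exact h.trans (max_le (Cardinal.lift_le_aleph0.2 Cardinal.mk_le_aleph0) le_rfl)

theorem exists_isRelAlgClosed_extension {k F₁ F₂ : Type*} [Field k] [CharZero k] [Field F₁]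
    [Field F₂] [Algebra k F₁] [Algebra k F₂]
    (h : ∀ g : k[X], (∃ x : F₁, aeval x g = 0) ↔ (∃ x : F₂, aeval x g = 0)) :
    ∃ ι₂ : algebraicClosure k F₁ →ₐ[k] F₂,
      IsRelAlgClosed (ι₂ : algebraicClosure k F₁ →+* F₂) := by
  obtain ⟨e⟩ := Field.nonempty_algEquiv_of_aeval_eq_zero_eq (F := k)
    (E := algebraicClosure k F₁) (K := algebraicClosure k F₂)
    (Set.ext fun p => (exists_aeval_algebraicClosure_iff p).trans
      ((h p).trans (exists_aeval_algebraicClosure_iff p).symm))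
  refine ⟨(algebraicClosure k F₂).val.comp (e : _ →ₐ[k] _), ?_⟩
  exact (isRelAlgClosed_algebraicClosure k F₂).comp_equiv e.toRingEquiv

end

section
open Polynomial IntermediateField

section
variable {k M Q : Type*} [Field k] [Field M] [Field Q] [Algebra k M] [Algebra k Q]
  (F : Type*) [Field F] [Algebra k F] [Algebra F Q] [IsScalarTower k F Q]

/-- The elements of `M` whose image under an embedding into an extension of `F` lies in `F`. -/
noncomputable def traceField (j : M →ₐ[k] Q) : IntermediateField k M :=
  (IsScalarTower.toAlgHom k F Q).fieldRange.comap j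

theorem exists_aeval_iff_traceField (j : M →ₐ[k] Q) {g : k[X]} (hg : g ≠ 0)
    (hs : (g.map (algebraMap k M)).Splits) :
    (∃ x : F, aeval x g = 0) ↔ ∃ x ∈ traceField F j, aeval x g = 0 := by
  constructor
  · rintro ⟨x, hx⟩
    have h1 : ((g.map (algebraMap k M)).map (j : M →+* Q)).IsRoot (algebraMap F Q x) := by
      rw [IsRoot, Polynomial.map_map, AlgHom.comp_algebraMap, eval_map_algebraMap,
        aeval_algebraMap_apply, hx, map_zero]
    obtain ⟨m, hm⟩ := hs.mem_range_of_isRoot ((Polynomial.map_ne_zero_iff (algebraMap k M).injective).2 hg) h1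
    refine ⟨m, ⟨x, hm.symm⟩, j.injective ?_⟩
    replace hm : j m = algebraMap F Q x := hm
    change j (aeval m g) = j 0
    rw [← aeval_algHom_apply j, map_zero, hm, aeval_algebraMap_apply, hx, map_zero]
  · rintro ⟨m, ⟨x, hx⟩, hm⟩
    replace hx : algebraMap F Q x = j m := hx
    refine ⟨x, (algebraMap F Q).injective ?_⟩
    rw [← aeval_algebraMap_apply, map_zero, hx, aeval_algHom_apply, hm, map_zero]

theorem finrank_traceField_le [FiniteDimensional k M] (j : M →ₐ[k] Q) (η : M) {h : F[X]}
    (hroot : aeval (j η) h = 0) (hdeg : h.natDegree = Module.finrank k M) {d : ℕ}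
    (H : ∀ u : F[X], u.Monic → 0 < u.natDegree → u ∣ h → h.natDegree ≤ d * u.natDegree) :
    Module.finrank k (traceField F j) ≤ d := by
  have hInt : IsIntegral (traceField F j) η := Algebra.IsIntegral.isIntegral η
  obtain ⟨r, hr, hrdeg, hrm⟩ := lifts_and_natDegree_eq_and_monic (f := algebraMap F Q)
    (p := (minpoly (traceField F j) η).map ((j : M →+* Q).comp (algebraMap _ M)))
    ((lifts_iff_coeff_lifts _).2 fun n => by
      rw [coeff_map]
      exact ((minpoly (traceField F j) η).coeff n).2) ((minpoly.monic hInt).map _)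
  have hr0 : aeval (j η) r = 0 := by
    rw [← eval_map_algebraMap, hr, eval_map]
    change eval₂ ((j : M →+* Q).comp (algebraMap _ M)) ((j : M →+* Q) η) _ = 0
    rw [← hom_eval₂ _ (algebraMap _ M) (j : M →+* Q) η, ← aeval_def, minpoly.aeval, map_zero]
  have hjint : IsIntegral F (j η) := ⟨r, hrm, hr0⟩
  have h1 := H (minpoly F (j η)) (minpoly.monic hjint) (minpoly.natDegree_pos hjint)
    (minpoly.dvd _ _ hroot)
  have h2 : (minpoly F (j η)).natDegree ≤ Module.finrank (traceField F j) M := by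
    refine (natDegree_le_natDegree (minpoly.min F (j η) hrm hr0)).trans ?_
    rw [hrdeg, (minpoly.monic hInt).natDegree_map]
    exact minpoly.natDegree_le η
  have h3 := Module.finrank_mul_finrank k (traceField F j) M
  have h4 : 0 < Module.finrank (traceField F j) M := Module.finrank_pos
  refine Nat.le_of_mul_le_mul_right ?_ h4
  rw [h3, ← hdeg]
  exact h1.trans (Nat.mul_le_mul_left d h2)

end

theorem exists_integral_primitive_element (A : Type*) {k M : Type*} [CommRing A] [IsDomain A]
    [Field k] [CharZero k] [Field M]
    [Algebra A k] [IsFractionRing A k] [Algebra k M] [Algebra A M] [IsScalarTower A k M]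
    [FiniteDimensional k M] (N : IntermediateField k M) :
    ∃ α : M, IsIntegral A α ∧ k⟮α⟯ = N := by
  obtain ⟨α₀, hα₀⟩ := Field.exists_primitive_element k N
  have hN : k⟮(α₀ : M)⟯ = N := by
    rw [← lift_adjoin_simple, hα₀, lift_top]
  have halg : IsAlgebraic A (α₀ : M) :=
    (IsFractionRing.isAlgebraic_iff A k M).2 (Algebra.IsAlgebraic.isAlgebraic _)
  obtain ⟨y, hy, hyα⟩ := halg.exists_integral_multiple
  refine ⟨y • (α₀ : M), hyα, ?_⟩
  refine Eq.trans ?_ hN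
  have hy' : algebraMap A k y ≠ 0 := fun h => hy (by
    apply IsFractionRing.injective A k
    rw [h, map_zero])
  rw [← IsScalarTower.algebraMap_smul k y (α₀ : M)]
  refine le_antisymm (adjoin_simple_le_iff.2 (smul_mem _ (mem_adjoin_simple_self k _)))
    (adjoin_simple_le_iff.2 ?_)
  have := smul_mem _ (mem_adjoin_simple_self k (algebraMap A k y • (α₀ : M))) (x := (algebraMap A k y)⁻¹)
  rwa [smul_smul, inv_mul_cancel₀ hy', one_smul] at this

theorem exists_root_transfer {A k F₁ : Type*} [CommRing A] [IsDomain A] [IsIntegrallyClosed A]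
    [Field k] [CharZero k] [Algebra A k] [IsFractionRing A k] [Field F₁] [Algebra k F₁]
    {G : k[X]} (hG : G ≠ 0) :
    ∃ f h : A[X], f.Monic ∧ 0 < f.natDegree ∧ h.Monic ∧ Irreducible h ∧
      (∃ α : F₁, aeval α (f.map (algebraMap A k)) = 0 ∧ ∀ P : A[X], P.Monic →
        aeval α (P.map (algebraMap A k)) = 0 → f.natDegree ≤ P.natDegree) ∧
      ∀ (F₂ : Type*) [Field F₂] [Algebra k F₂],
        (∃ x : F₂, aeval x (f.map (algebraMap A k)) = 0) →
        (∀ u : F₂[X], u.Monic → 0 < u.natDegree →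
          u ∣ (h.map (algebraMap A k)).map (algebraMap k F₂) →
          h.natDegree ≤ f.natDegree * u.natDegree) →
        ∀ g : k[X], g ∣ G → ((∃ x : F₁, aeval x g = 0) ↔ ∃ x : F₂, aeval x g = 0) := by
  let M := SplittingField G
  have hnormal : Normal k M := Normal.of_isSplittingField G
  let j₁ : M →ₐ[k] AlgebraicClosure F₁ := IsAlgClosed.lift
  obtain ⟨α, hα, hkα⟩ := exists_integral_primitive_element A (traceField F₁ j₁)
  obtain ⟨η, hη, hkη⟩ := exists_integral_primitive_element A (⊤ : IntermediateField k M)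
  have hα' : α ∈ traceField F₁ j₁ := hkα ▸ mem_adjoin_simple_self k α
  obtain ⟨α₁, hα₁⟩ := hα'
  have hmα : minpoly k α = (minpoly A α).map (algebraMap A k) :=
    minpoly.isIntegrallyClosed_eq_field_fractions' k hα
  have hmη : minpoly k η = (minpoly A η).map (algebraMap A k) :=
    minpoly.isIntegrallyClosed_eq_field_fractions' k hη
  replace hα₁ : algebraMap F₁ (AlgebraicClosure F₁) α₁ = j₁ α := hα₁
  have hα₁0 : ∀ g : k[X], aeval α₁ g = 0 ↔ aeval α g = 0 := fun g => by
    rw [← map_eq_zero_iff _ (algebraMap F₁ (AlgebraicClosure F₁)).injective,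
      ← aeval_algebraMap_apply, ← map_eq_zero_iff j₁ j₁.injective, ← aeval_algHom_apply j₁, hα₁]
  have hdη : (minpoly A η).natDegree = Module.finrank k M := by
    rw [← (minpoly.monic hη).natDegree_map (algebraMap A k), ← hmη,
      ← adjoin.finrank (Algebra.IsIntegral.isIntegral η), hkη, finrank_top']
  refine ⟨minpoly A α, minpoly A η, minpoly.monic hα, minpoly.natDegree_pos hα, minpoly.monic hη,
    minpoly.irreducible hη, ⟨α₁, ?_, fun P hP hP0 => ?_⟩, fun F₂ _ _ hroot hu g hgG => ?_⟩
  · rw [hα₁0, ← hmα, minpoly.aeval]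
  · rw [hα₁0, aeval_map_algebraMap] at hP0
    exact natDegree_le_natDegree (minpoly.min A α hP hP0)
  have hs : (g.map (algebraMap k M)).Splits := (SplittingField.splits G).of_dvd
    ((Polynomial.map_ne_zero_iff (algebraMap k M).injective).2 hG) (Polynomial.map_dvd _ hgG)
  have hsα : ((minpoly k α).map (algebraMap k M)).Splits := hnormal.splits α
  let j₂ : M →ₐ[k] AlgebraicClosure F₂ := IsAlgClosed.lift
  rw [← hmα, exists_aeval_iff_traceField F₂ j₂ (minpoly.ne_zero (Algebra.IsIntegral.isIntegral α)) hsα] at hroot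
  obtain ⟨β, hβ, hβ0⟩ := hroot
  obtain ⟨σ, hσ⟩ := minpoly.exists_algEquiv_of_root' (Algebra.IsAlgebraic.isAlgebraic α) hβ0
  have hle : k⟮β⟯ ≤ traceField F₂ j₂ := adjoin_simple_le_iff.2 hβ
  have hmap : k⟮α⟯.map (σ : M →ₐ[k] M) = k⟮β⟯ := by
    rw [adjoin_map, Set.image_singleton]
    exact congrArg _ (congrArg _ hσ)
  have hfin : Module.finrank k k⟮β⟯ = (minpoly A α).natDegree := by
    rw [← (minpoly.monic hα).natDegree_map (algebraMap A k), ← hmα,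
      ← hσ, adjoin.finrank (Algebra.IsIntegral.isIntegral _), minpoly.algEquiv_eq]
  have hle2 : Module.finrank k (traceField F₂ j₂) ≤ (minpoly A α).natDegree := by
    refine finrank_traceField_le F₂ j₂ η (h := ((minpoly A η).map (algebraMap A k)).map (algebraMap k F₂))
      ?_ ?_ fun u hu1 hu2 hu3 => ?_
    · rw [aeval_map_algebraMap, ← hmη, aeval_algHom_apply, minpoly.aeval, map_zero]
    · rw [((minpoly.monic hη).map _).natDegree_map, (minpoly.monic hη).natDegree_map, hdη]
    · rw [((minpoly.monic hη).map _).natDegree_map, (minpoly.monic hη).natDegree_map]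
      exact hu u hu1 hu2 hu3
  have heq : k⟮β⟯ = traceField F₂ j₂ := eq_of_le_of_finrank_le hle (hfin ▸ hle2)
  have hg0 : g ≠ 0 := fun h => hG (zero_dvd_iff.1 (h ▸ hgG))
  rw [exists_aeval_iff_traceField F₁ j₁ hg0 hs, exists_aeval_iff_traceField F₂ j₂ hg0 hs,
    ← heq, ← hkα, ← hmap]
  constructor
  · rintro ⟨x, hx, hx0⟩
    exact ⟨σ x, ⟨x, hx, rfl⟩, by rw [aeval_algHom_apply, hx0, map_zero]⟩
  · rintro ⟨_, ⟨x, hx, rfl⟩, hx0⟩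
    refine ⟨x, hx, σ.injective ?_⟩
    rw [map_zero, ← hx0]
    exact (aeval_algHom_apply (σ : M →ₐ[k] M) x g).symm

end

section
open Polynomial

theorem IsRelAlgClosed.eval₂RingHom_injective {E F : Type*} [Field E] [Field F] {ι : E →+* F}
    (hι : IsRelAlgClosed ι) {a : F} (ha : a ∉ ι.range) :
    Function.Injective (eval₂RingHom ι a) := by
  rw [injective_iff_map_eq_zero]
  intro p hp
  by_contra h
  exact ha (hι a p h hp)

theorem exists_root_transfer_eval₂ {E F₁ : Type*} [Field E] [CharZero E] [Field F₁] {ι : E →+* F₁}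
    (hι : IsRelAlgClosed ι) {a : F₁} (ha : a ∉ ι.range) (S : Finset E[X][X]) :
    ∃ f h : E[X][X], f.Monic ∧ h.Monic ∧ Irreducible h ∧
      (∀ (L : Type*) [Field L] (ψ : E →+* L), Irreducible (f.map (mapRingHom ψ))) ∧
      ∀ (F₂ : Type*) [Field F₂] (θ : E[X] →+* F₂), Function.Injective θ →
        (∃ x, eval x (f.map θ) = 0) →
        (∀ u : F₂[X], u.Monic → 0 < u.natDegree → u ∣ h.map θ →
          h.natDegree ≤ f.natDegree * u.natDegree) →
        ∀ g ∈ S, (∃ x, eval x (g.map (eval₂RingHom ι a)) = 0) ↔ ∃ x, eval x (g.map θ) = 0 := by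
  classical
  let k := FractionRing E[X]
  have : CharZero F₁ := charZero_of_injective_ringHom ι.injective
  have : CharZero k := charZero_of_injective_algebraMap (IsFractionRing.injective E[X] k)
  let _ : Algebra k F₁ := (IsFractionRing.lift (hι.eval₂RingHom_injective ha)).toAlgebra
  have hcomp : (algebraMap k F₁).comp (algebraMap E[X] k) = eval₂RingHom ι a :=
    RingHom.ext fun p => IsFractionRing.lift_algebraMap (hι.eval₂RingHom_injective ha) p
  let T := (S.filter (· ≠ 0)).image fun g => g.map (algebraMap E[X] k)
  have hG : T.prod id ≠ 0 := by
    rw [Finset.prod_ne_zero_iff]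
    intro q hq
    obtain ⟨g, hg, rfl⟩ := Finset.mem_image.1 hq
    exact (Polynomial.map_ne_zero_iff (IsFractionRing.injective E[X] k)).2 (Finset.mem_filter.1 hg).2
  obtain ⟨f, h, hf, hf0, hh, hhirr, ⟨α, hα, hmin⟩, H⟩ :=
    exists_root_transfer (A := E[X]) (F₁ := F₁) hG
  have haev : ∀ (x : F₁) (P : E[X][X]), aeval x (P.map (algebraMap E[X] k)) =
      eval x (P.map (eval₂RingHom ι a)) := fun x P => by
    rw [← eval_map_algebraMap, map_map, hcomp]
  refine ⟨f, h, hf, hh, hhirr, fun L _ ψ => ?_, fun F₂ _ θ hθ hroot hu g hg => ?_⟩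
  · refine irreducible_map_of_minimal hι hf hf0 (a := a) (α := α) (by rw [← haev, hα])
      (fun P hP hP0 => hmin P hP (by rw [haev, hP0])) ψ
  · by_cases hg0 : g = 0
    · simp [hg0]
    let _ : Algebra k F₂ := (IsFractionRing.lift hθ).toAlgebra
    have hcomp2 : (algebraMap k F₂).comp (algebraMap E[X] k) = θ :=
      RingHom.ext fun p => IsFractionRing.lift_algebraMap hθ p
    have haev2 : ∀ (x : F₂) (P : E[X][X]), aeval x (P.map (algebraMap E[X] k)) =
        eval x (P.map θ) := fun x P => by
      rw [← eval_map_algebraMap, map_map, hcomp2]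
    have := H F₂ (by simpa only [haev2] using hroot) (by rwa [map_map, hcomp2])
      (g.map (algebraMap E[X] k)) (Finset.dvd_prod_of_mem id (Finset.mem_image_of_mem _
        (Finset.mem_filter.2 ⟨hg, hg0⟩)))
    simpa only [haev, haev2] using this

theorem exists_common_extension {k F₁ F₂ : Type} [Field k] [CharZero k] [Countable k] [Field F₁]
    [Field F₂] (φ₁ : k →+* F₁) (φ₂ : k →+* F₂)
    (h : ∀ g : k[X], (∃ x, eval₂ φ₁ x g = 0) ↔ ∃ x, eval₂ φ₂ x g = 0) :
    ∃ (E : Type) (_ : Field E) (_ : Countable E) (j : k →+* E) (ι₁ : E →+* F₁) (ι₂ : E →+* F₂),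
      IsRelAlgClosed ι₁ ∧ IsRelAlgClosed ι₂ ∧ ι₁.comp j = φ₁ ∧ ι₂.comp j = φ₂ := by
  let _ : Algebra k F₁ := φ₁.toAlgebra
  let _ : Algebra k F₂ := φ₂.toAlgebra
  obtain ⟨ι₂, hι₂⟩ := exists_isRelAlgClosed_extension (k := k) (F₁ := F₁) (F₂ := F₂) h
  exact ⟨algebraicClosure k F₁, inferInstance, countable_of_isAlgebraic k _, algebraMap k _,
    algebraMap _ F₁, ι₂, isRelAlgClosed_algebraicClosure k F₁, hι₂, rfl, ι₂.comp_algebraMap⟩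

theorem exists_forth {M Q : Type} [Field M] [CharZero M] [Field Q] (κ : M →+* Q) (N : Set M)
    (hspec : ∀ f h : M[X][X], f.Monic → h.Monic → Irreducible (f.map (mapRingHom κ)) →
      Irreducible h → ∀ e : ℕ → M, ∃ a ∈ N, (∀ n, a ≠ e n) ∧
        (∃ x, eval x (f.map (evalRingHom a)) = 0) ∧
        ∀ u : M[X], u.Monic → 0 < u.natDegree → u ∣ h.map (evalRingHom a) →
          h.natDegree ≤ f.natDegree * u.natDegree)
    (hsat : ∀ (g : ℕ → M[X][X]) (b : ℕ → Prop) (e : ℕ → M),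
      (∀ n, ∃ a ∈ N, ∀ i ≤ n, a ≠ e i ∧ ((∃ y, eval y ((g i).map (evalRingHom a)) = 0) ↔ b i)) →
      ∃ a ∈ N, ∀ i, a ≠ e i ∧ ((∃ y, eval y ((g i).map (evalRingHom a)) = 0) ↔ b i))
    {E : Type} [Field E] [Countable E] {ι₁ ι₂ : E →+* M} (h₁ : IsRelAlgClosed ι₁)
    (h₂ : IsRelAlgClosed ι₂) {a : M} (ha : a ∉ ι₁.range) :
    ∃ (E' : Type) (_ : Field E') (_ : Countable E') (j : E →+* E') (κ₁ κ₂ : E' →+* M),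
      IsRelAlgClosed κ₁ ∧ IsRelAlgClosed κ₂ ∧ κ₁.comp j = ι₁ ∧ κ₂.comp j = ι₂ ∧
      ∃ x, κ₁ x = a ∧ κ₂ x ∈ N := by
  have : CharZero E := (ι₁.charZero_iff ι₁.injective).2 inferInstance
  have : Countable E[X] := countable_polynomial
  have : Countable E[X][X] := countable_polynomial
  obtain ⟨g, hg⟩ := exists_surjective_nat E[X][X]
  obtain ⟨e, he⟩ := exists_surjective_nat E
  have hmap : ∀ (P : E[X][X]) (a' : M), (P.map (mapRingHom ι₂)).map (evalRingHom a') =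
      P.map (eval₂RingHom ι₂ a') := fun P a' => by
    rw [map_map]
    congr 1
    refine ringHom_ext (fun x => ?_) ?_ <;> simp
  have hnot : ∀ a' : M, (∀ n, a' ≠ ι₂ (e n)) → a' ∉ ι₂.range := by
    rintro a' h ⟨x, rfl⟩
    obtain ⟨n, rfl⟩ := he x
    exact h n rfl
  obtain ⟨a', ha'N, ha'⟩ := hsat (fun i => (g i).map (mapRingHom ι₂))
    (fun i => ∃ y, eval y ((g i).map (eval₂RingHom ι₁ a)) = 0) (fun i => ι₂ (e i)) (by
      classical
      intro n
      obtain ⟨f, h, hf, hh, hhirr, hfirr, H⟩ := exists_root_transfer_eval₂ h₁ ha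
        ((Finset.range (n + 1)).image g)
      obtain ⟨a', ha'N, ha'e, hroot, hu⟩ := hspec (f.map (mapRingHom ι₂)) (h.map (mapRingHom ι₂))
        (hf.map _) (hh.map _) (by
          rw [map_map, mapRingHom_comp]
          exact hfirr Q _) (irreducible_map_of_isRelAlgClosed h₂ hh hhirr) (fun i => ι₂ (e i))
      refine ⟨a', ha'N, fun i hi => ⟨ha'e i, ?_⟩⟩
      rw [hmap] at hroot ⊢
      simp only [hmap, hf.natDegree_map, hh.natDegree_map] at hu
      exact (H M (eval₂RingHom ι₂ a') (h₂.eval₂RingHom_injective (hnot a' ha'e)) hroot hu (g i)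
        (Finset.mem_image_of_mem _ (Finset.mem_range.2 (Nat.lt_succ_of_le hi)))).symm)
  have hinj₁ := h₁.eval₂RingHom_injective ha
  have hinj₂ := h₂.eval₂RingHom_injective (hnot a' fun n => (ha' n).1)
  have hall : ∀ P : E[X][X], (∃ y, eval y (P.map (eval₂RingHom ι₁ a)) = 0) ↔
      ∃ y, eval y (P.map (eval₂RingHom ι₂ a')) = 0 := fun P => by
    obtain ⟨i, rfl⟩ := hg P
    rw [← hmap]
    exact (ha' i).2.symm
  have : Countable (FractionRing E[X]) := (IsLocalization.mk'_surjective (nonZeroDivisors E[X])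
    (S := FractionRing E[X])).countable
  have : CharZero (FractionRing E[X]) :=
    charZero_of_injective_algebraMap (IsFractionRing.injective E[X] (FractionRing E[X]))
  have hcomp₁ : (IsFractionRing.lift hinj₁ : FractionRing E[X] →+* M).comp (algebraMap E[X] _) =
      eval₂RingHom ι₁ a := RingHom.ext fun p => IsFractionRing.lift_algebraMap hinj₁ p
  have hcomp₂ : (IsFractionRing.lift hinj₂ : FractionRing E[X] →+* M).comp (algebraMap E[X] _) =
      eval₂RingHom ι₂ a' := RingHom.ext fun p => IsFractionRing.lift_algebraMap hinj₂ p
  obtain ⟨E', _, _, j, κ₁, κ₂, hκ₁, hκ₂, hj₁, hj₂⟩ := exists_common_extension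
    (k := FractionRing E[X]) (IsFractionRing.lift hinj₁) (IsFractionRing.lift hinj₂) (by
      intro q
      obtain ⟨u, hu, hq⟩ := IsLocalization.integerNormalization_spec (nonZeroDivisors E[X]) q
      have hu0 : algebraMap E[X] (FractionRing E[X]) u ≠ 0 := fun h =>
        nonZeroDivisors.ne_zero hu (IsFractionRing.injective E[X] (FractionRing E[X])
          (by rw [h, map_zero]))
      have key : ∀ (φ : FractionRing E[X] →+* M) (θ : E[X] →+* M)
          (hφ : φ.comp (algebraMap E[X] _) = θ) (x : M),
          eval x ((IsLocalization.integerNormalization (nonZeroDivisors E[X]) q).map θ) = 0 ↔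
            eval₂ φ x q = 0 := by
        intro φ θ hφ x
        rw [← hφ, ← map_map, hq, ← algebraMap_smul (FractionRing E[X]) u q, smul_eq_C_mul,
          Polynomial.map_mul, eval_mul, map_C, eval_C, eval_map, mul_eq_zero]
        simp [hu0]
      have := hall (IsLocalization.integerNormalization (nonZeroDivisors E[X]) q)
      simpa only [key _ _ hcomp₁, key _ _ hcomp₂] using this)
  refine ⟨E', inferInstance, inferInstance, j.comp ((algebraMap E[X] _).comp C), κ₁, κ₂, hκ₁, hκ₂,
    ?_, ?_, j (algebraMap E[X] _ X), ?_, ?_⟩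
  · rw [← RingHom.comp_assoc, hj₁, ← RingHom.comp_assoc, hcomp₁]
    ext; simp
  · rw [← RingHom.comp_assoc, hj₂, ← RingHom.comp_assoc, hcomp₂]
    ext; simp
  · have := congrArg (fun φ => φ (algebraMap E[X] (FractionRing E[X]) X)) hj₁
    simpa using this
  · have := congrArg (fun φ => φ (algebraMap E[X] (FractionRing E[X]) X)) hj₂
    simp only [RingHom.comp_apply, IsFractionRing.lift_algebraMap, coe_eval₂RingHom, eval₂_X] at this
    rw [this]
    exact ha'N

section
variable {M : Type} [Field M] [FirstOrder.Ring.CompatibleRing M]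

lemma exists_realize_term_eq {E : Type} [Field E] {β : Type} (t : Language.ring.Term β)
    (w : β → E) : ∃ y : E, ∀ ι : E →+* M, t.realize (fun b => ι (w b)) = ι y := by
  induction t with
  | var b => exact ⟨w b, fun ι => rfl⟩
  | func f ts ih =>
    choose y hy using ih
    cases f with
    | add => exact ⟨y 0 + y 1, fun ι => by simp [Language.Term.realize, hy, map_add]⟩
    | mul => exact ⟨y 0 * y 1, fun ι => by simp [Language.Term.realize, hy, map_mul]⟩
    | neg => exact ⟨-y 0, fun ι => by simp [Language.Term.realize, hy, map_neg]⟩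
    | zero => exact ⟨0, fun ι => by simp [Language.Term.realize]⟩
    | one => exact ⟨1, fun ι => by simp [Language.Term.realize]⟩

/-- Elementary extension property: an embedding pair of countable relatively algebraically closed
fields into `M` can be extended so as to contain any prescribed element in the first image, with
partner in `N`. -/
def HasForth (N : Set M) : Prop :=
  ∀ {E : Type} [Field E] [Countable E] {ι₁ ι₂ : E →+* M}, IsRelAlgClosed ι₁ → IsRelAlgClosed ι₂ →
    ∀ {a : M}, a ∉ ι₁.range → ∃ (E' : Type) (_ : Field E') (_ : Countable E') (j : E →+* E')
      (κ₁ κ₂ : E' →+* M), IsRelAlgClosed κ₁ ∧ IsRelAlgClosed κ₂ ∧ κ₁.comp j = ι₁ ∧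
        κ₂.comp j = ι₂ ∧ ∃ x, κ₁ x = a ∧ κ₂ x ∈ N

lemma realize_iff_of_hasForth {N : Set M} (hN : HasForth N) {β : Type} {n : ℕ}
    (φ : Language.ring.BoundedFormula β n) : ∀ {E : Type} [Field E] [Countable E]
    {ι₁ ι₂ : E →+* M}, IsRelAlgClosed ι₁ → IsRelAlgClosed ι₂ → ∀ (v : β → E) (xs : Fin n → E),
    φ.Realize (fun b => ι₁ (v b)) (fun i => ι₁ (xs i)) ↔
      φ.Realize (fun b => ι₂ (v b)) (fun i => ι₂ (xs i)) := by
  induction φ with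
  | falsum => intros; rfl
  | equal t₁ t₂ =>
    intro E _ _ ι₁ ι₂ _ _ v xs
    obtain ⟨y₁, hy₁⟩ := exists_realize_term_eq (M := M) t₁ (Sum.elim v xs)
    obtain ⟨y₂, hy₂⟩ := exists_realize_term_eq (M := M) t₂ (Sum.elim v xs)
    have key : ∀ ι : E →+* M, Sum.elim (fun b => ι (v b)) (fun i => ι (xs i)) =
        fun c => ι (Sum.elim v xs c) := by
      intro ι; ext c; cases c <;> rfl
    simp only [Language.BoundedFormula.Realize, key, hy₁, hy₂, ι₁.injective.eq_iff,
      ι₂.injective.eq_iff]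
  | rel R ts => exact isEmptyElim R
  | imp f₁ f₂ ih₁ ih₂ =>
    intro E _ _ ι₁ ι₂ h₁ h₂ v xs
    simp only [Language.BoundedFormula.realize_imp, ih₁ h₁ h₂, ih₂ h₁ h₂]
  | @all k f ih =>
    have one : ∀ {E : Type} [Field E] [Countable E] {ι₁ ι₂ : E →+* M}, IsRelAlgClosed ι₁ →
        IsRelAlgClosed ι₂ → ∀ (v : β → E) (xs : Fin k → E),
        (f.all.Realize (fun b => ι₂ (v b)) (fun i => ι₂ (xs i)) →
          f.all.Realize (fun b => ι₁ (v b)) (fun i => ι₁ (xs i))) := by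
      intro E _ _ ι₁ ι₂ h₁ h₂ v xs H
      rw [Language.BoundedFormula.realize_all] at H ⊢
      intro a
      have snoc : ∀ {E' : Type} [Field E'] (κ : E' →+* M) (ys : Fin k → E') (x : E'),
          (Fin.snoc (fun i => κ (ys i)) (κ x) : Fin (k + 1) → M) =
            fun i => κ ((Fin.snoc ys x : Fin (k + 1) → E') i) := by
        intro E' _ κ ys x
        funext i
        refine Fin.lastCases ?_ (fun i => ?_) i
        · simp only [Fin.snoc_last]
        · simp only [Fin.snoc_castSucc]
      by_cases ha : a ∈ ι₁.range
      · obtain ⟨x, rfl⟩ := ha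
        have := H (ι₂ x)
        rw [snoc] at this ⊢
        exact (ih h₁ h₂ _ _).2 this
      · obtain ⟨E', _, _, j, κ₁, κ₂, k₁, k₂, rfl, rfl, x, rfl, -⟩ := hN h₁ h₂ ha
        have := H (κ₂ x)
        simp only [RingHom.comp_apply] at this ⊢
        rw [snoc κ₂ (fun i => j (xs i)) x] at this
        rw [snoc κ₁ (fun i => j (xs i)) x]
        exact (ih k₁ k₂ (fun b => j (v b)) _).2 this
    intro E _ _ ι₁ ι₂ h₁ h₂ v xs
    exact ⟨one h₂ h₁ v xs, one h₁ h₂ v xs⟩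

lemma exists_realize_mem_of_hasForth {N : Set M} (hN : HasForth N) {E : Type} [Field E]
    [Countable E] {ι : E →+* M} (hι : IsRelAlgClosed ι) {β γ : Type}
    (φ : Language.ring.Formula (β ⊕ γ)) (v : β → E) (c : E) {a : M} (ha : a ∉ ι.range)
    (h : φ.Realize (Sum.elim (fun b => ι (v b)) (fun _ => a - ι c))) :
    ∃ a' ∈ N, φ.Realize (Sum.elim (fun b => ι (v b)) (fun _ => a' - ι c)) := by
  obtain ⟨E', _, _, j, κ₁, κ₂, k₁, k₂, e₁, e₂, x, rfl, hx⟩ := hN hι hι ha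
  refine ⟨κ₂ x, hx, ?_⟩
  have key : ∀ κ : E' →+* M, κ.comp j = ι → Sum.elim (fun b => ι (v b)) (fun _ : γ => κ x - ι c) =
        fun d => κ (Sum.elim (fun b => j (v b)) (fun _ => x - j c) d) := by
      rintro κ rfl; ext d; cases d <;> simp
  rw [key κ₁ e₁] at h
  rw [key κ₂ e₂]
  have := (realize_iff_of_hasForth hN φ k₁ k₂
    (Sum.elim (fun b => j (v b)) (fun _ : γ => x - j c)) default)
  unfold Language.Formula.Realize at h ⊢
  rw [show (default : Fin 0 → M) = fun i => κ₂ ((default : Fin 0 → E') i) from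
    Subsingleton.elim _ _]
  rw [show (default : Fin 0 → M) = fun i => κ₁ ((default : Fin 0 → E') i) from
    Subsingleton.elim _ _] at h
  exact this.1 h
end

end

section
open Polynomial Filter

/-- The ultrapower of `A` along a nonprincipal ultrafilter on the naturals. -/
def Ultrapower (A : Type) : Type := Germ (hyperfilter ℕ : Filter ℕ) A

noncomputable instance (A : Type) [Field A] : Field (Ultrapower A) :=
  inferInstanceAs (Field (Germ (hyperfilter ℕ : Filter ℕ) A))

/-- The class of a sequence in the ultrapower. -/
noncomputable def germHom (A : Type) [Field A] : (ℕ → A) →+* Ultrapower A :=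
  (Germ.coeRingHom _ : (ℕ → A) →+* Germ (hyperfilter ℕ : Filter ℕ) A)

lemma germHom_surjective (A : Type) [Field A] : Function.Surjective (germHom A) := by
  intro x
  induction x using Germ.inductionOn with
  | h f => exact ⟨f, rfl⟩

lemma germHom_eq_iff {A : Type} [Field A] {x y : ℕ → A} :
    germHom A x = germHom A y ↔ ∀ᶠ j in hyperfilter ℕ, x j = y j :=
  Germ.coe_eq

/-- The structure on the ultrapower of a field in the language of rings. -/
@[reducible] noncomputable def ultrapowerCompatibleRing (F : Type) [Field F]
    [FirstOrder.Ring.CompatibleRing F] :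
    FirstOrder.Ring.CompatibleRing (Ultrapower F) where
  toStructure := (inferInstance : Language.ring.Structure
    (((hyperfilter ℕ : Ultrafilter ℕ) : Filter ℕ).Product fun _ : ℕ => F))
  funMap_add := by
    intro x
    choose y hy using fun i => germHom_surjective F (x i)
    obtain rfl : (fun i => germHom F (y i)) = x := funext hy
    refine (Language.Ultraproduct.funMap_cast (M := fun _ : ℕ => F) (u := hyperfilter ℕ) _ y).trans ?_
    simp only [FirstOrder.Ring.CompatibleRing.funMap_add]
    rfl
  funMap_mul := by
    intro x
    choose y hy using fun i => germHom_surjective F (x i)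
    obtain rfl : (fun i => germHom F (y i)) = x := funext hy
    refine (Language.Ultraproduct.funMap_cast (M := fun _ : ℕ => F) (u := hyperfilter ℕ) _ y).trans ?_
    simp only [FirstOrder.Ring.CompatibleRing.funMap_mul]
    rfl
  funMap_neg := by
    intro x
    choose y hy using fun i => germHom_surjective F (x i)
    obtain rfl : (fun i => germHom F (y i)) = x := funext hy
    refine (Language.Ultraproduct.funMap_cast (M := fun _ : ℕ => F) (u := hyperfilter ℕ) _ y).trans ?_
    simp only [FirstOrder.Ring.CompatibleRing.funMap_neg]
    rfl
  funMap_zero := by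
    intro x
    choose y hy using fun i => germHom_surjective F (x i)
    obtain rfl : (fun i => germHom F (y i)) = x := funext hy
    refine (Language.Ultraproduct.funMap_cast (M := fun _ : ℕ => F) (u := hyperfilter ℕ) _ y).trans ?_
    simp only [FirstOrder.Ring.CompatibleRing.funMap_zero]
    rfl
  funMap_one := by
    intro x
    choose y hy using fun i => germHom_surjective F (x i)
    obtain rfl : (fun i => germHom F (y i)) = x := funext hy
    refine (Language.Ultraproduct.funMap_cast (M := fun _ : ℕ => F) (u := hyperfilter ℕ) _ y).trans ?_
    simp only [FirstOrder.Ring.CompatibleRing.funMap_one]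
    rfl

lemma ultrapower_realize_iff {F : Type} [Field F] [FirstOrder.Ring.CompatibleRing F] {β : Type}
    (φ : Language.ring.Formula β) (x : β → ℕ → F) :
    letI := ultrapowerCompatibleRing F
    φ.Realize (fun b => germHom F (x b)) ↔ ∀ᶠ j in hyperfilter ℕ, φ.Realize fun b => x b j :=
  Language.Ultraproduct.realize_formula_cast (M := fun _ : ℕ => F) (u := hyperfilter ℕ) φ x

theorem eval_map_evalRingHom_map {A B : Type*} [CommRing A] [CommRing B] (ψ : A →+* B)
    (P : A[X][X]) (a x : A) :
    eval (ψ x) ((P.map (mapRingHom ψ)).map (evalRingHom (ψ a))) =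
      ψ (eval x (P.map (evalRingHom a))) := by
  rw [Polynomial.map_map, show (evalRingHom (ψ a)).comp (mapRingHom ψ) = ψ.comp (evalRingHom a) by
    ext <;> simp, ← Polynomial.map_map, eval_map_hom]

theorem map_evalRingHom_map {A B : Type*} [CommRing A] [CommRing B] (ψ : A →+* B)
    (P : A[X][X]) (a : A) :
    (P.map (mapRingHom ψ)).map (evalRingHom (ψ a)) = (P.map (evalRingHom a)).map ψ := by
  rw [Polynomial.map_map, show (evalRingHom (ψ a)).comp (mapRingHom ψ) = ψ.comp (evalRingHom a) by
    ext <;> simp, ← Polynomial.map_map]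

theorem eventually_map_eq_of_map_eq {A : Type} [Field A] {P Q : (ℕ → A)[X]}
    (h : P.map (germHom A) = Q.map (germHom A)) :
    ∀ᶠ j in hyperfilter ℕ, P.map (Pi.evalRingHom _ j) = Q.map (Pi.evalRingHom _ j) := by
  have h1 : ∀ i ∈ Finset.range (max P.natDegree Q.natDegree + 1),
      ∀ᶠ j in hyperfilter ℕ, P.coeff i j = Q.coeff i j := by
    intro i _
    have := congrArg (fun p => p.coeff i) h
    simp only [coeff_map] at this
    exact germHom_eq_iff.1 this
  filter_upwards [(Filter.eventually_all_finset _).2 h1] with j hj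
  ext i
  simp only [coeff_map, Pi.evalRingHom_apply]
  by_cases hi : i ∈ Finset.range (max P.natDegree Q.natDegree + 1)
  · exact hj i hi
  · rw [Finset.mem_range] at hi
    rw [coeff_eq_zero_of_natDegree_lt (by lia), coeff_eq_zero_of_natDegree_lt (by lia)]

theorem eventually_map_mapRingHom_eq {A : Type} [Field A] {P Q : (ℕ → A)[X][X]}
    (h : P.map (mapRingHom (germHom A)) = Q.map (mapRingHom (germHom A))) :
    ∀ᶠ j in hyperfilter ℕ,
      P.map (mapRingHom (Pi.evalRingHom _ j)) = Q.map (mapRingHom (Pi.evalRingHom _ j)) := by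
  have h1 : ∀ i ∈ Finset.range (max P.natDegree Q.natDegree + 1), ∀ᶠ j in hyperfilter ℕ,
      (P.coeff i).map (Pi.evalRingHom _ j) = (Q.coeff i).map (Pi.evalRingHom _ j) := by
    intro i _
    have := congrArg (fun p => p.coeff i) h
    simp only [coeff_map, coe_mapRingHom] at this
    exact eventually_map_eq_of_map_eq this
  filter_upwards [(Filter.eventually_all_finset _).2 h1] with j hj
  ext1 i
  simp only [coeff_map, coe_mapRingHom]
  by_cases hi : i ∈ Finset.range (max P.natDegree Q.natDegree + 1)
  · exact hj i hi
  · rw [Finset.mem_range] at hi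
    rw [coeff_eq_zero_of_natDegree_lt (n := i) (by lia), coeff_eq_zero_of_natDegree_lt (by lia)]

theorem map_mapRingHom_germHom_eq {A : Type} [Field A] {P Q : (ℕ → A)[X][X]}
    (h : ∀ᶠ j in hyperfilter ℕ,
      P.map (mapRingHom (Pi.evalRingHom _ j)) = Q.map (mapRingHom (Pi.evalRingHom _ j))) :
    P.map (mapRingHom (germHom A)) = Q.map (mapRingHom (germHom A)) := by
  ext i k
  simp only [coeff_map, coe_mapRingHom]
  refine germHom_eq_iff.2 (h.mono fun j hj => ?_)
  simpa using congrArg (fun p => (p.coeff i).coeff k) hj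

theorem map_mapRingHom_germHom_surjective (A : Type) [Field A] :
    Function.Surjective (Polynomial.map (mapRingHom (germHom A))) :=
  Polynomial.map_surjective (mapRingHom (germHom A))
    (Polynomial.map_surjective _ (germHom_surjective A))

theorem coeff_coeff_swap {A : Type*} [CommRing A] (P : A[X][X]) (i j : ℕ) :
    ((Bivariate.swap P).coeff i).coeff j = (P.coeff j).coeff i := by
  induction P using Polynomial.induction_on' with
  | add p q hp hq => simp [hp, hq]
  | monomial n p =>
    induction p using Polynomial.induction_on' with
    | add p q hp hq => simp only [map_add, coeff_add, hp, hq]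
    | monomial m r =>
      rw [Bivariate.swap_monomial_monomial]
      simp only [coeff_monomial]
      split_ifs <;> simp_all [coeff_monomial]

theorem coeff_coeff_eq_zero_of_mul {K : Type*} [Field K] {u v H : K[X][X]} (hH : H ≠ 0)
    (h : H = u * v) {M : ℕ} (hM : ∀ i j, M < j → (H.coeff i).coeff j = 0) (i j : ℕ)
    (hj : M < j) : (u.coeff i).coeff j = 0 := by
  have h1 : Bivariate.swap H = Bivariate.swap u * Bivariate.swap v := by rw [h, map_mul]
  have h2 : (Bivariate.swap H).natDegree ≤ M := natDegree_le_iff_coeff_eq_zero.2 fun k hk => by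
    ext l
    rw [coeff_coeff_swap, hM _ _ hk, coeff_zero]
  have h3 : Bivariate.swap H ≠ 0 := (map_ne_zero_iff _ Bivariate.swap.injective).2 hH
  rw [h1] at h2 h3
  rw [natDegree_mul (left_ne_zero_of_mul h3) (right_ne_zero_of_mul h3)] at h2
  rw [← coeff_coeff_swap, coeff_eq_zero_of_natDegree_lt (n := j) (by lia), coeff_zero]

theorem exists_lift_of_bound {K : Type} [Field K] {D M : ℕ} (u : ℕ → K[X][X])
    (hu : ∀ᶠ k in hyperfilter ℕ, ∀ i j, D < i ∨ M < j → ((u k).coeff i).coeff j = 0) :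
    ∃ U : (ℕ → K)[X][X], ∀ᶠ k in hyperfilter ℕ, U.map (mapRingHom (Pi.evalRingHom _ k)) = u k := by
  classical
  obtain ⟨U, hU⟩ := exists_polynomial_coeff
    (fun i j k => if D < i ∨ M < j then 0 else ((u k).coeff i).coeff j : ℕ → ℕ → ℕ → K) D M
    (fun i j h => by ext k; simp [h])
  refine ⟨U, hu.mono fun k hk => ?_⟩
  ext i j
  simp only [coeff_map, coe_mapRingHom, hU, Pi.evalRingHom_apply]
  split_ifs with h
  · exact (hk i j h).symm
  · rfl

theorem not_isUnit_of_eventually {A : Type} [Field A] {U : (ℕ → A)[X][X]}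
    (h : ∀ᶠ k in hyperfilter ℕ, ¬ IsUnit (U.map (mapRingHom (Pi.evalRingHom _ k)))) :
    ¬ IsUnit (U.map (mapRingHom (germHom A))) := by
  intro hu
  obtain ⟨w, hw⟩ := isUnit_iff_exists_inv.1 hu
  obtain ⟨W, rfl⟩ := map_mapRingHom_germHom_surjective A w
  rw [← Polynomial.map_mul, ← Polynomial.map_one (mapRingHom (germHom A))] at hw
  obtain ⟨k, h1, h2⟩ := (h.and (eventually_map_mapRingHom_eq hw)).exists
  rw [Polynomial.map_mul, Polynomial.map_one] at h2
  exact h1 (isUnit_iff_exists_inv.2 ⟨_, h2⟩)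

theorem eventually_irreducible_of_irreducible {K : Type} [Field K] {H : (ℕ → K)[X][X]}
    (hm : H.Monic) (hH : Irreducible (H.map (mapRingHom (germHom K)))) :
    ∀ᶠ k in hyperfilter ℕ, Irreducible (H.map (mapRingHom (Pi.evalRingHom _ k))) := by
  by_contra hcon
  rw [← Ultrafilter.eventually_not] at hcon
  have hnu : ∀ᶠ k in hyperfilter ℕ, ¬ IsUnit (H.map (mapRingHom (Pi.evalRingHom _ k))) := by
    by_contra hc
    rw [← Ultrafilter.eventually_not] at hc
    refine hH.not_isUnit ?_
    rw [map_mapRingHom_germHom_eq (Q := 1) (hc.mono fun k hk => ?_), Polynomial.map_one]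
    · exact isUnit_one
    · rw [Polynomial.map_one]
      exact (hm.map _).eq_one_of_isUnit (not_not.1 hk)
  have hex : ∀ k, ∃ u v : K[X][X], ¬ IsUnit (H.map (mapRingHom (Pi.evalRingHom _ k))) →
      ¬ Irreducible (H.map (mapRingHom (Pi.evalRingHom _ k))) →
      H.map (mapRingHom (Pi.evalRingHom _ k)) = u * v ∧ ¬ IsUnit u ∧ ¬ IsUnit v := by
    intro k
    by_contra! hc
    obtain ⟨h1, h2, -⟩ := hc 0 0
    refine h2 ⟨h1, fun u v huv => ?_⟩
    by_contra! h3
    exact h3.2 ((hc u v).2.2 huv h3.1)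
  choose u v huv using hex
  obtain ⟨M, hM⟩ := exists_coeff_bound H
  have hbd : ∀ k (a b : K[X][X]), H.map (mapRingHom (Pi.evalRingHom _ k)) = a * b →
      ∀ i j, H.natDegree < i ∨ M < j → (a.coeff i).coeff j = 0 := by
    intro k a b hab i j hij
    have hne : H.map (mapRingHom (Pi.evalRingHom _ k)) ≠ 0 := (hm.map _).ne_zero
    rcases hij with hi | hj
    · have h1 : a * b ≠ 0 := hab ▸ hne
      have h2 := congrArg natDegree hab
      rw [hm.natDegree_map, natDegree_mul (left_ne_zero_of_mul h1) (right_ne_zero_of_mul h1)] at h2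
      rw [coeff_eq_zero_of_natDegree_lt (n := i) (by lia), coeff_zero]
    · refine coeff_coeff_eq_zero_of_mul hne hab (M := M) (fun i j hj => ?_) i j hj
      simp [coeff_map, hM i j (Or.inr hj)]
  have hall := hnu.and hcon
  obtain ⟨U, hU⟩ := exists_lift_of_bound (D := H.natDegree) (M := M) u
    (hall.mono fun k hk => hbd k _ _ (huv k hk.1 hk.2).1)
  obtain ⟨V, hV⟩ := exists_lift_of_bound (D := H.natDegree) (M := M) v
    (hall.mono fun k hk => hbd k _ _ ((huv k hk.1 hk.2).1.trans (mul_comm _ _)))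
  have hUV : H.map (mapRingHom (germHom K)) = (U * V).map (mapRingHom (germHom K)) := by
    refine map_mapRingHom_germHom_eq ?_
    filter_upwards [hall, hU, hV] with k hk h1 h2
    rw [Polynomial.map_mul, h1, h2]
    exact (huv k hk.1 hk.2).1
  rw [Polynomial.map_mul] at hUV
  rcases hH.isUnit_or_isUnit hUV with h | h
  · refine not_isUnit_of_eventually ?_ h
    filter_upwards [hall, hU] with k hk h1
    rw [h1]
    exact (huv k hk.1 hk.2).2.1
  · refine not_isUnit_of_eventually ?_ h
    filter_upwards [hall, hV] with k hk h1
    rw [h1]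
    exact (huv k hk.1 hk.2).2.2

theorem exists_diagonal {α : Type*} (B : ℕ → ℕ → α → Prop)
    (h : ∀ n, ∃ t : ℕ → α, ∀ i ≤ n, ∀ᶠ j in hyperfilter ℕ, B i j (t j)) :
    ∃ t : ℕ → α, ∀ i, ∀ᶠ j in hyperfilter ℕ, B i j (t j) := by
  classical
  have : Nonempty α := ⟨(h 0).choose 0⟩
  have hex : ∀ j, ∃ t, ∀ k < Nat.findGreatest (fun n => ∃ t, ∀ k < n, B k j t) j, B k j t :=
    fun j => Nat.findGreatest_spec (P := fun n => ∃ t, ∀ k < n, B k j t) (Nat.zero_le j)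
      ⟨Classical.arbitrary α, fun k hk => absurd hk (Nat.not_lt_zero k)⟩
  choose t ht using hex
  refine ⟨t, fun i => ?_⟩
  obtain ⟨s, hs⟩ := h i
  have h1 : ∀ᶠ j in hyperfilter ℕ, ∀ k ∈ Finset.range (i + 1), B k j (s j) :=
    (Filter.eventually_all_finset _).2 fun k hk => hs k (by simpa [Nat.lt_succ_iff] using hk)
  have h2 : ∀ᶠ j in hyperfilter ℕ, i + 1 ≤ j :=
    Nat.hyperfilter_le_atTop (Filter.eventually_ge_atTop _)
  filter_upwards [h1, h2] with j hj hij
  exact ht j i (Nat.le_findGreatest hij ⟨s j, fun k hk => hj k (Finset.mem_range.2 hk)⟩)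

/-- The map on ultrapowers induced by a homomorphism of fields. -/
theorem exists_ultrapower_map {F Q : Type} [Field F] [Field Q] (κ₀ : F →+* Q) :
    ∃ κ : Ultrapower F →+* Ultrapower Q,
      κ.comp (germHom F) = (germHom Q).comp (RingHom.pi fun j => κ₀.comp (Pi.evalRingHom _ j)) := by
  have hle : RingHom.ker (germHom F) ≤
      RingHom.ker ((germHom Q).comp (RingHom.pi fun j => κ₀.comp (Pi.evalRingHom _ j))) := by
    intro x hx
    rw [RingHom.mem_ker, ← map_zero (germHom F), germHom_eq_iff] at hx
    rw [RingHom.mem_ker, ← map_zero (germHom Q), RingHom.comp_apply, germHom_eq_iff]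
    refine hx.mono fun j hj => ?_
    change κ₀ (x j) = 0
    rw [hj, Pi.zero_apply, map_zero]
  refine ⟨(germHom F).liftOfSurjective (germHom_surjective F) ⟨_, hle⟩, ?_⟩
  exact RingHom.liftOfRightInverse_comp _ _ _ ⟨_, hle⟩

/-- The classes of sequences of naturals in an ultrapower. -/
def hypernaturals (F : Type) [Field F] : Set (Ultrapower F) :=
  Set.range fun t : ℕ → ℕ => germHom F fun j => (t j : F)

theorem exists_eval_eq_zero_iff {F : Type} [Field F] (G : (ℕ → F)[X][X]) (a : ℕ → F) :
    (∃ y, eval y ((G.map (mapRingHom (germHom F))).map (evalRingHom (germHom F a))) = 0) ↔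
      ∀ᶠ j in hyperfilter ℕ, ∃ y,
        eval y ((G.map (mapRingHom (Pi.evalRingHom _ j))).map (evalRingHom (a j))) = 0 := by
  have key : ∀ (y : ℕ → F) (j : ℕ),
      eval (y j) ((G.map (mapRingHom (Pi.evalRingHom _ j))).map (evalRingHom (a j))) =
        eval y (G.map (evalRingHom a)) j := fun y j =>
    eval_map_evalRingHom_map (Pi.evalRingHom (fun _ : ℕ => F) j) G a y
  constructor
  · rintro ⟨y, hy⟩
    obtain ⟨y, rfl⟩ := germHom_surjective F y
    rw [eval_map_evalRingHom_map, ← map_zero (germHom F), germHom_eq_iff] at hy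
    exact hy.mono fun j hj => ⟨y j, by rw [key, hj]; rfl⟩
  · intro h
    obtain ⟨y, hy⟩ := h.choice
    refine ⟨germHom F y, ?_⟩
    rw [eval_map_evalRingHom_map, ← map_zero (germHom F), germHom_eq_iff]
    exact hy.mono fun j hj => by rw [← key, hj]; rfl

/-- Every pair of polynomials over `F`, the first one geometrically irreducible, has good
specializations at arbitrarily large naturals. -/
def HasSpecializations {F Q : Type} [Field F] [Field Q] (κ₀ : F →+* Q) : Prop :=
  ∀ f h : F[X][X], f.Monic → h.Monic → Irreducible (f.map (mapRingHom κ₀)) → Irreducible h →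
    ∀ n₀ : ℕ, ∃ t > n₀, (∃ x, eval x (f.map (evalRingHom (t : F))) = 0) ∧
      ∀ u : F[X], u.Monic → 0 < u.natDegree → u ∣ h.map (evalRingHom (t : F)) →
        h.natDegree ≤ f.natDegree * u.natDegree

theorem exists_bound_natCast_ne {F : Type} [Field F] [CharZero F] (ε : ℕ → F) (j : ℕ) :
    ∃ n₀ : ℕ, ∀ i ≤ j, ∀ t : ℕ, t > n₀ → (t : F) ≠ ε i := by
  have : ∀ i, ∃ n : ℕ, ∀ t : ℕ, t > n → (t : F) ≠ ε i := by
    intro i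
    by_cases h : ∃ s : ℕ, (s : F) = ε i
    · obtain ⟨s, hs⟩ := h
      refine ⟨s, fun t ht he => ?_⟩
      rw [← hs, Nat.cast_inj] at he
      lia
    · exact ⟨0, fun t _ he => h ⟨t, he⟩⟩
  choose n hn using this
  exact ⟨(Finset.range (j + 1)).sup n, fun i hi t ht =>
    hn i t (lt_of_le_of_lt (Finset.le_sup (Finset.mem_range.2 (Nat.lt_succ_of_le hi))) ht)⟩

theorem exists_mem_hypernaturals_specialization {F Q : Type} [Field F] [CharZero F] [Field Q]
    {κ₀ : F →+* Q} (H : HasSpecializations κ₀) {κ : Ultrapower F →+* Ultrapower Q}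
    (hκ : κ.comp (germHom F) =
      (germHom Q).comp (RingHom.pi fun j => κ₀.comp (Pi.evalRingHom _ j)))
    (f h : (Ultrapower F)[X][X]) (hf : f.Monic) (hh : h.Monic)
    (hfi : Irreducible (f.map (mapRingHom κ))) (hhi : Irreducible h) (e : ℕ → Ultrapower F) :
    ∃ a ∈ hypernaturals F, (∀ n, a ≠ e n) ∧ (∃ x, eval x (f.map (evalRingHom a)) = 0) ∧
      ∀ u : (Ultrapower F)[X], u.Monic → 0 < u.natDegree → u ∣ h.map (evalRingHom a) →
        h.natDegree ≤ f.natDegree * u.natDegree := by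
  obtain ⟨f, fm, rfl⟩ := hf.exists_monic_lift (germHom F) fun i j => germHom_surjective F _
  obtain ⟨h, hm, rfl⟩ := hh.exists_monic_lift (germHom F) fun i j => germHom_surjective F _
  choose ε hε using fun i => germHom_surjective F (e i)
  let ev (j : ℕ) : (ℕ → F) →+* F := Pi.evalRingHom (fun _ : ℕ => F) j
  have h1 : ∀ᶠ j in hyperfilter ℕ,
      Irreducible ((f.map (mapRingHom (ev j))).map (mapRingHom κ₀)) := by
    rw [Polynomial.map_map, mapRingHom_comp, hκ, ← mapRingHom_comp, ← Polynomial.map_map] at hfi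
    refine (eventually_irreducible_of_irreducible (fm.map _) hfi).mono fun j hj => ?_
    rw [Polynomial.map_map, mapRingHom_comp] at hj ⊢
    exact hj
  have h2 : ∀ᶠ j in hyperfilter ℕ, Irreducible (h.map (mapRingHom (ev j))) :=
    eventually_irreducible_of_irreducible hm hhi
  have hex : ∀ j, ∃ t : ℕ, Irreducible ((f.map (mapRingHom (ev j))).map (mapRingHom κ₀)) →
      Irreducible (h.map (mapRingHom (ev j))) → (∀ i ≤ j, (t : F) ≠ ε i j) ∧
      (∃ x, eval x ((f.map (mapRingHom (ev j))).map (evalRingHom (t : F))) = 0) ∧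
      ∀ u : F[X], u.Monic → 0 < u.natDegree →
        u ∣ (h.map (mapRingHom (ev j))).map (evalRingHom (t : F)) →
        (h.map (mapRingHom (ev j))).natDegree ≤
          (f.map (mapRingHom (ev j))).natDegree * u.natDegree := by
    intro j
    by_cases hj : Irreducible ((f.map (mapRingHom (ev j))).map (mapRingHom κ₀)) ∧
      Irreducible (h.map (mapRingHom (ev j)))
    · obtain ⟨n₀, hn₀⟩ := exists_bound_natCast_ne (fun i => ε i j) j
      obtain ⟨t, ht, ht'⟩ := H _ _ (fm.map _) (hm.map _) hj.1 hj.2 n₀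
      exact ⟨t, fun _ _ => ⟨fun i hi => hn₀ i hi t ht, ht'⟩⟩
    · exact ⟨0, fun a b => absurd ⟨a, b⟩ hj⟩
  choose t ht using hex
  have hall := h1.and h2
  refine ⟨_, ⟨t, rfl⟩, fun n hn => ?_, ?_, fun u um ud hu => ?_⟩
  · rw [← hε, germHom_eq_iff] at hn
    have h3 : ∀ᶠ j in hyperfilter ℕ, n ≤ j :=
      Nat.hyperfilter_le_atTop (Filter.eventually_ge_atTop _)
    obtain ⟨j, ⟨hj, hj'⟩, hj''⟩ := ((hall.and hn).and h3).exists
    exact (ht j hj.1 hj.2).1 n hj'' hj'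
  · rw [exists_eval_eq_zero_iff]
    exact hall.mono fun j hj => (ht j hj.1 hj.2).2.1
  · obtain ⟨w, hw⟩ := hu
    obtain ⟨w, rfl⟩ := Polynomial.map_surjective _ (germHom_surjective F) w
    obtain ⟨u, rfl, -, vm⟩ := lifts_and_natDegree_eq_and_monic
      ((mem_lifts (f := germHom F) u).2 (Polynomial.map_surjective _ (germHom_surjective F) u)) um
    rw [map_evalRingHom_map, ← Polynomial.map_mul] at hw
    obtain ⟨j, hj, hj'⟩ := (hall.and (eventually_map_eq_of_map_eq hw)).exists
    rw [vm.natDegree_map] at ud ⊢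
    have := (ht j hj.1 hj.2).2.2 (u.map (ev j)) (vm.map _) (by rwa [vm.natDegree_map])
      ⟨w.map (ev j), by
        rw [← Polynomial.map_mul, ← hj']
        exact map_evalRingHom_map (ev j) h fun j => (t j : F)⟩
    rw [vm.natDegree_map, hm.natDegree_map, fm.natDegree_map] at this
    rwa [hm.natDegree_map, fm.natDegree_map]

theorem hypernaturals_saturated {F : Type} [Field F] (g : ℕ → (Ultrapower F)[X][X])
    (b : ℕ → Prop) (e : ℕ → Ultrapower F)
    (h : ∀ n, ∃ a ∈ hypernaturals F, ∀ i ≤ n,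
      a ≠ e i ∧ ((∃ y, eval y ((g i).map (evalRingHom a)) = 0) ↔ b i)) :
    ∃ a ∈ hypernaturals F, ∀ i,
      a ≠ e i ∧ ((∃ y, eval y ((g i).map (evalRingHom a)) = 0) ↔ b i) := by
  choose ε hε using fun i => germHom_surjective F (e i)
  choose G hG using fun i => map_mapRingHom_germHom_surjective F (g i)
  have key : ∀ (t : ℕ → ℕ) (i : ℕ), (∀ᶠ j in hyperfilter ℕ, (t j : F) ≠ ε i j ∧
      ((∃ y, eval y (((G i).map (mapRingHom (Pi.evalRingHom _ j))).map
        (evalRingHom (t j : F))) = 0) ↔ b i)) ↔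
      ((germHom F fun j => (t j : F)) ≠ e i ∧
      ((∃ y, eval y ((g i).map (evalRingHom (germHom F fun j => (t j : F)))) = 0) ↔ b i)) := by
    intro t i
    rw [← hε, ← hG, Filter.eventually_and, Ultrafilter.eventually_not, exists_eval_eq_zero_iff, Ne,
      germHom_eq_iff]
    by_cases hb : b i
    · simp [hb]
    · simp [hb]
  obtain ⟨t, ht⟩ := exists_diagonal (fun i j (t : ℕ) => (t : F) ≠ ε i j ∧
      ((∃ y, eval y (((G i).map (mapRingHom (Pi.evalRingHom _ j))).map
        (evalRingHom (t : F))) = 0) ↔ b i)) (fun n => by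
    obtain ⟨_, ⟨t, rfl⟩, ht⟩ := h n
    exact ⟨t, fun i hi => (key t i).2 (ht i hi)⟩)
  exact ⟨_, ⟨t, rfl⟩, fun i => (key t i).1 (ht i)⟩

/-- The diagonal embedding of a field in its ultrapower. -/
noncomputable def diagonalHom (F : Type) [Field F] : F →+* Ultrapower F :=
  (germHom F).comp (Pi.constRingHom ℕ F)

theorem isRelAlgClosed_diagonalHom (F : Type) [Field F] : IsRelAlgClosed (diagonalHom F) := by
  intro x p hp hx
  obtain ⟨ξ, rfl⟩ := germHom_surjective F x
  rw [diagonalHom, ← hom_eval₂, ← map_zero (germHom F), germHom_eq_iff] at hx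
  have h1 : ∀ᶠ j in hyperfilter ℕ, ∃ c ∈ p.rootSet F, ξ j = c := by
    refine hx.mono fun j hj => ⟨ξ j, (mem_rootSet_of_ne hp).2 ?_, rfl⟩
    have h2 := hom_eval₂ p (Pi.constRingHom ℕ F) (Pi.evalRingHom (fun _ : ℕ => F) j) ξ
    rw [Pi.evalRingHom_apply, hj] at h2
    exact h2.symm
  rw [Ultrafilter.eventually_exists_mem_iff (rootSet_finite p F)] at h1
  obtain ⟨c, -, hc⟩ := h1
  exact ⟨c, (germHom_eq_iff.2 hc).symm⟩

theorem hasForth_hypernaturals {F Q : Type} [Field F] [CharZero F] [Field Q]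
    {κ₀ : F →+* Q} (H : HasSpecializations κ₀) : HasForth (hypernaturals F) := by
  intro E _ _ ι₁ ι₂ h₁ h₂ a ha
  have : CharZero (Ultrapower F) := charZero_of_injective_ringHom (diagonalHom F).injective
  obtain ⟨κ, hκ⟩ := exists_ultrapower_map κ₀
  exact exists_forth κ (hypernaturals F)
    (fun f h hf hh hfi hhi e => exists_mem_hypernaturals_specialization H hκ f h hf hh hfi hhi e)
    hypernaturals_saturated h₁ h₂ ha

theorem exists_natCast_sub_mem {F Q : Type} [Field F] [CharZero F] [Countable F] [Field Q]
    {κ₀ : F →+* Q} (H : HasSpecializations κ₀) {S : Set F} (hS : DefinableIn F S)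
    (hinf : S.Infinite) (c : F) : ∃ t : ℕ, (t : F) - c ∈ S := by
  let _ := FirstOrder.Ring.compatibleRingOfRing F
  let _ := ultrapowerCompatibleRing F
  obtain ⟨φ, hφ⟩ := Set.definable_iff_exists_formula_sum.1
    (show Set.Definable (Set.univ : Set F) Language.ring {x : Fin 1 → F | x 0 ∈ S} from hS)
  have hφ' : ∀ x : F, x ∈ S ↔ φ.Realize (Sum.elim (fun b => (b : F)) fun _ => x) := fun x => by
    have := congrArg (fun s => (fun _ : Fin 1 => x) ∈ s) hφ
    exact iff_of_eq this
  let s : ℕ → F := fun n => (hinf.natEmbedding S n : F)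
  have hs : Function.Injective s := Subtype.val_injective.comp (hinf.natEmbedding S).injective
  have hx : ∀ x : ℕ → F,
      φ.Realize (Sum.elim (fun b => diagonalHom F (b : F)) fun _ => germHom F x) ↔
        ∀ᶠ j in hyperfilter ℕ, x j ∈ S := fun x => by
    simp only [hφ']
    refine Iff.trans (iff_of_eq (congrArg _ ?_)) ((ultrapower_realize_iff φ
      (Sum.elim (fun b _ => (b : F)) fun _ => x)).trans (iff_of_eq (congrArg
        (fun p => Filter.Eventually p _) (funext fun j => congrArg _ ?_))))
    · ext b; cases b <;> rfl
    · ext b; cases b <;> rfl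
  obtain ⟨_, ⟨t, rfl⟩, ht⟩ := exists_realize_mem_of_hasForth (hasForth_hypernaturals H)
    (isRelAlgClosed_diagonalHom F) φ (fun b => (b : F)) c
    (a := germHom F s + diagonalHom F c) (by
      rintro ⟨y, hy⟩
      have : germHom F s = germHom F fun _ => y - c := by
        rw [← sub_eq_iff_eq_add, ← map_sub] at hy
        exact hy.symm
      rw [germHom_eq_iff] at this
      have hfin : {j | s j = y - c}.Finite :=
        (Set.finite_singleton (y - c)).preimage hs.injOn
      exact Filter.notMem_hyperfilter_of_finite hfin this)
    (by
      rw [add_sub_cancel_right, hx]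
      exact Filter.Eventually.of_forall fun j => (hinf.natEmbedding S j).2)
  have ht' : ∀ᶠ j in hyperfilter ℕ, (t j : F) - c ∈ S :=
    (hx fun j => (t j : F) - c).1 ht
  obtain ⟨j, hj⟩ := ht'.exists
  exact ⟨t j, hj⟩

theorem hasSpecializations_of_notMem_badSet {F : Subfield Qbar}
    (hF : ∀ f h n₀, F ∉ badSet f h n₀) : HasSpecializations F.subtype := by
  intro f h fm hm hf hh n₀
  have := hF (f.map (mapRingHom F.subtype)) (h.map (mapRingHom F.subtype)) n₀
  have hex : ∃ t > n₀, IsGoodSpecialization F (f.map (mapRingHom F.subtype))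
      (h.map (mapRingHom F.subtype)) t := by
    by_contra! hc
    exact this ⟨⟨f, h, rfl, rfl, fm, hm, hh⟩, hf, hc⟩
  obtain ⟨t, ht, ⟨x, hxF, hx⟩, h2⟩ := hex
  have hcast : ((t : ℕ) : Qbar) = F.subtype (t : F) := (map_natCast F.subtype t).symm
  refine ⟨t, ht, ⟨⟨x, hxF⟩, ?_⟩, fun u um ud hu => ?_⟩
  · rw [hcast, show x = F.subtype ⟨x, hxF⟩ from rfl, eval_map_evalRingHom_map] at hx
    exact (map_eq_zero_iff _ F.subtype.injective).1 hx
  · have := h2 u um ud (by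
      rw [hcast, map_evalRingHom_map]
      exact Polynomial.map_dvd _ hu)
    rwa [hm.natDegree_map, fm.natDegree_map] at this

theorem not_definableIn_of_integral {F : Subfield Qbar} (H : HasSpecializations F.subtype)
    {S : Set F} (hZ : intSet F ⊆ S) (hS : ∀ x ∈ S, IsIntegral ℤ x) : ¬ DefinableIn F S := by
  intro hd
  have hinf : S.Infinite :=
    (Set.infinite_range_of_injective (Int.cast_injective (α := F))).mono hZ
  obtain ⟨t, ht⟩ := exists_natCast_sub_mem H hd hinf (1 / 2)
  have h1 : IsIntegral ℤ (algebraMap ℚ F (1 / 2)) := by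
    have := (isIntegral_natCast (R := ℤ) (B := F) (a := t)).sub (hS _ ht)
    simpa using this
  rw [isIntegral_algebraMap_iff (algebraMap ℚ F).injective] at h1
  obtain ⟨n, hn⟩ := IsIntegrallyClosed.isIntegral_iff.1 h1
  have h2 : ((2 * n : ℤ) : ℚ) = 1 := by
    push_cast
    rw [show (n : ℚ) = 1 / 2 from hn]
    norm_num
  have h3 : 2 * n = 1 := by exact_mod_cast h2
  lia

end

/-- For every number field `K ⊆ Q̄`, the set of isomorphism classes of subfields `F` of `Q̄`
in which `ℤ` is definable, or the ring of integers `𝒪_F` is definable, or `K ⊆ F` and the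
subset `K` is definable (in each case by a first-order formula in the language of rings
with parameters from `F`), is meager in `𝓔̄`. -/
theorem meager_in_quotient (K : Subfield Qbar) (hK : FiniteDimensional ℚ K) :
    IsMeagre ((Quotient.mk isoSetoid) ''
      {F : Subfield Qbar |
        DefinableIn F (intSet F) ∨ DefinableIn F (ringOfIntegers F) ∨
          (K ≤ F ∧ DefinableIn F {x : F | (x : Qbar) ∈ K})}) := by
  refine isMeagre_image_of_subset K hK fun F hF => ?_
  by_contra! hcon
  have H := hasSpecializations_of_notMem_badSet hcon.2
  rcases hF with hd | hd | ⟨hKF, hd⟩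
  · refine not_definableIn_of_integral H subset_rfl ?_ hd
    rintro _ ⟨n, rfl⟩
    exact isIntegral_algebraMap (R := ℤ) (x := n)
  · refine not_definableIn_of_integral H ?_ (fun x hx => hx) hd
    rintro _ ⟨n, rfl⟩
    exact isIntegral_algebraMap (R := ℤ) (x := n)
  · obtain ⟨c, hcF, hcK⟩ := SetLike.exists_of_lt (lt_of_le_of_ne hKF hcon.1.symm)
    have hinf : {x : F | (x : Qbar) ∈ K}.Infinite :=
      (Set.infinite_range_of_injective (Nat.cast_injective (R := F))).mono (by
        rintro _ ⟨n, rfl⟩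
        change ((n : F) : Qbar) ∈ K
        push_cast
        exact natCast_mem K n)
    have : Countable F := inferInstance
    obtain ⟨t, ht⟩ := exists_natCast_sub_mem H hd hinf ⟨c, hcF⟩
    refine hcK ?_
    have h1 := K.sub_mem (natCast_mem K t) ht
    simpa using h1
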